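/- arXiv:1001.0312 — 4 statements merged into one kernel-verified Lean document; each statement's English description precedes it below -/
import Mathlib

section
/- Watson's identity: Let q, a be complex numbers with |q| < 1 and a q^j ≠ 1 for every integer j ≥ 0. Then ∑_{k=0}^∞ (−1)^k · (1 − a q^{2k}) / ((q;q)_k · (a q^k;q)_∞) · a^{2k} · q^{k(5k−1)/2} = ∑_{n=0}^∞ a^n q^{n²} / (q;q)_n, where both series converge absolutely. -/
/-- The finite q-Pochhammer symbol `(a; q)_k = ∏_{i=0}^{k-1} (1 - a q^i)`. -/
noncomputable def qPoch (q a : ℂ) (k : ℕ) : ℂ := ∏ i ∈ Finset.range k, (1 - a * q ^ i)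

/-- The infinite q-Pochhammer symbol `(a; q)_∞ = ∏_{i=0}^{∞} (1 - a q^i)`. -/
noncomputable def qPochInf (q a : ℂ) : ℂ := ∏' i : ℕ, (1 - a * q ^ i)

open Filter Topology

lemma one_sub_q_ne {q : ℂ} (hq : ‖q‖ < 1) (n : ℕ) : 1 - q * q ^ n ≠ 0 := by
  intro h
  have h1 : q ^ (n + 1) = 1 := by rw [pow_succ']; linear_combination -h
  have h2 : ‖q‖ ^ (n + 1) < 1 := pow_lt_one₀ (norm_nonneg _) hq (by omega)
  rw [← norm_pow, h1] at h2
  simp at h2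

lemma qPoch_succ (q a : ℂ) (n : ℕ) : qPoch q a (n + 1) = qPoch q a n * (1 - a * q ^ n) := by
  simp [qPoch, Finset.prod_range_succ]

lemma qPoch_ne {q : ℂ} (hq : ‖q‖ < 1) (n : ℕ) : qPoch q q n ≠ 0 :=
  Finset.prod_ne_zero_iff.2 fun i _ => one_sub_q_ne hq i

lemma tendsto_q {q : ℂ} (hq : ‖q‖ < 1) : Tendsto (fun n : ℕ => q ^ n) atTop (𝓝 0) :=
  tendsto_pow_atTop_nhds_zero_of_norm_lt_one hq

lemma summable_aq {q : ℂ} (hq : ‖q‖ < 1) (a : ℂ) : Summable fun i : ℕ => ‖-(a * q ^ i)‖ := by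
  simp only [norm_neg, norm_mul, norm_pow]
  exact (summable_geometric_of_lt_one (norm_nonneg _) hq).mul_left _

lemma mult_aq {q : ℂ} (hq : ‖q‖ < 1) (a : ℂ) : Multipliable fun i : ℕ => 1 - a * q ^ i := by
  simpa [sub_eq_add_neg] using multipliable_one_add_of_summable (summable_aq hq a)

lemma qPochInf_ne {q : ℂ} (hq : ‖q‖ < 1) {a : ℂ} (ha : ∀ j : ℕ, a * q ^ j ≠ 1) :
    qPochInf q a ≠ 0 := by
  have := tprod_one_add_ne_zero_of_summable (f := fun i : ℕ => -(a * q ^ i))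
    (fun i h => ha i (by linear_combination -h)) (summable_aq hq a)
  simpa [qPochInf, sub_eq_add_neg] using this

lemma qPochInf_split {q : ℂ} (hq : ‖q‖ < 1) (a : ℂ) (k : ℕ) :
    qPoch q a k * qPochInf q (a * q ^ k) = qPochInf q a := by
  have h : (fun n : ℕ => 1 - a * q ^ k * q ^ n) = fun n => (fun i => 1 - a * q ^ i) (n + k) := by
    funext n; simp only [pow_add]; ring
  have := Multipliable.prod_mul_tprod_nat_mul' (f := fun i : ℕ => 1 - a * q ^ i) (k := k)
    (by rw [← h]; exact mult_aq hq _)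
  rw [← h] at this
  exact this

lemma ha_shift {q a : ℂ} (ha : ∀ j : ℕ, a * q ^ j ≠ 1) (k : ℕ) : ∀ j : ℕ, a * q ^ k * q ^ j ≠ 1 := by
  intro j; rw [mul_assoc, ← pow_add]; exact ha _

/-- reciprocal of the infinite product -/
noncomputable def PW (q a : ℂ) (n : ℕ) : ℂ := (qPochInf q (a * q ^ n))⁻¹

lemma PW_shift (q a : ℂ) (N n : ℕ) : PW q (a * q ^ N) n = PW q a (N + n) := by
  simp [PW, pow_add, mul_assoc]

lemma PW_succ {q : ℂ} (hq : ‖q‖ < 1) {a : ℂ} (ha : ∀ j : ℕ, a * q ^ j ≠ 1) (n : ℕ) :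
    PW q a n * (1 - a * q ^ n) = PW q a (n + 1) := by
  have h := qPochInf_split hq (a * q ^ n) 1
  have h1 := qPochInf_ne hq (ha_shift ha n)
  have h2 := qPochInf_ne hq (ha_shift ha (n + 1))
  simp only [qPoch, Finset.prod_range_one, pow_zero, mul_one, pow_one, mul_assoc,
    ← pow_succ] at h
  unfold PW
  rw [← h] at h1 ⊢
  have h3 := left_ne_zero_of_mul h1
  field_simp

lemma PW_tendsto {q : ℂ} (hq : ‖q‖ < 1) {a : ℂ} (ha : ∀ j : ℕ, a * q ^ j ≠ 1) :
    Tendsto (PW q a) atTop (𝓝 1) := by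
  have h := (mult_aq hq a).tendsto_prod_tprod_nat
  have h0 : qPochInf q a ≠ 0 := qPochInf_ne hq ha
  have h1 := h.div_const (qPochInf q a)
  have e : (∏' i : ℕ, (1 - a * q ^ i)) / qPochInf q a = 1 := div_self h0
  rw [e] at h1
  refine h1.congr fun n => ?_
  have h2 := qPochInf_ne hq (ha_shift ha n)
  have h3 := qPochInf_split hq a n
  change qPoch q a n / _ = _
  have h4 : qPoch q a n ≠ 0 := by intro h; rw [h, zero_mul] at h3; exact h0 h3.symm
  rw [← h3, PW]; field_simp

lemma PW_bdd {q : ℂ} (hq : ‖q‖ < 1) {a : ℂ} (ha : ∀ j : ℕ, a * q ^ j ≠ 1) :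
    ∃ B : ℝ, 0 ≤ B ∧ ∀ n, ‖PW q a n‖ ≤ B := by
  obtain ⟨B, hB⟩ := (PW_tendsto hq ha).norm.bddAbove_range
  have : ∀ n, ‖PW q a n‖ ≤ B := fun n => hB ⟨n, rfl⟩
  exact ⟨B, (norm_nonneg _).trans (this 0), this⟩

lemma summable_ratio {q : ℂ} (hq : ‖q‖ < 1) {f u : ℕ → ℂ} (hu : Tendsto u atTop (𝓝 0))
    (h : ∀ n, f (n + 1) * (1 - q * q ^ n) = f n * u n) : Summable fun n => ‖f n‖ := by
  have h1 : Tendsto (fun n => u n / (1 - q * q ^ n)) atTop (𝓝 0) := by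
    have := hu.div (((tendsto_q hq).const_mul q).const_sub 1) (by simp)
    simp only [mul_zero, sub_zero, div_one] at this
    exact this
  have h2 := h1.norm
  rw [norm_zero] at h2
  have h3 : Summable fun n => ‖f n‖ := by
    refine summable_of_ratio_norm_eventually_le (r := 1 / 2) (by norm_num) ?_
    filter_upwards [h2.eventually (gt_mem_nhds (show (0:ℝ) < 1 / 2 by norm_num))] with n hn
    have : f (n + 1) = (u n / (1 - q * q ^ n)) * f n := by
      have := one_sub_q_ne hq n
      rw [eq_comm, div_mul_eq_mul_div, div_eq_iff this, h n, mul_comm]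
    rw [this]
    simp only [norm_mul, norm_norm]
    gcongr
  exact h3

/-- coefficients, product side -/
noncomputable def cW (q a : ℂ) (n : ℕ) : ℂ :=
  (-1) ^ n * a ^ (2 * n) * q ^ (5 * n.choose 2) / qPoch q q n

lemma choose_succ_two (n : ℕ) : (n + 1).choose 2 = n.choose 2 + n := by
  rw [Nat.choose_succ_succ' n 1]; simp [add_comm]

lemma cW_succ {q : ℂ} (hq : ‖q‖ < 1) (a : ℂ) (n : ℕ) :
    cW q a (n + 1) * (1 - q * q ^ n) = cW q a n * (-(a ^ 2 * q ^ (5 * n))) := by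
  have h1 := one_sub_q_ne hq n
  have h2 := qPoch_ne hq n
  simp only [cW, qPoch_succ, choose_succ_two]
  field_simp
  ring

lemma cW_shift (q a : ℂ) (N n : ℕ) : cW q (a * q ^ N) n = cW q a n * q ^ (N * (2 * n)) := by
  simp only [cW, mul_pow, ← pow_mul]; ring

lemma tendsto_q_mul {q : ℂ} (hq : ‖q‖ < 1) {m : ℕ} (hm : m ≠ 0) :
    Tendsto (fun n : ℕ => q ^ (n * m)) atTop (𝓝 0) := by
  have := (tendsto_q hq).pow m
  simpa [← pow_mul, hm] using this

lemma cW_summable {q : ℂ} (hq : ‖q‖ < 1) (a : ℂ) : Summable fun n => ‖cW q a n‖ := by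
  refine summable_ratio hq (u := fun n => -(a ^ 2 * q ^ (5 * n))) ?_ (cW_succ hq a)
  have := ((tendsto_q_mul hq (m := 5) (by norm_num)).const_mul (a ^ 2)).neg
  simpa [mul_comm] using this

/-- coefficients, sum side -/
noncomputable def fW (q a : ℂ) (n : ℕ) : ℂ := a ^ n * q ^ (n ^ 2) / qPoch q q n

lemma fW_succ {q : ℂ} (hq : ‖q‖ < 1) (a : ℂ) (n : ℕ) :
    fW q a (n + 1) * (1 - q * q ^ n) = fW q a n * (a * q ^ (2 * n + 1)) := by
  have h1 := one_sub_q_ne hq n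
  have h2 := qPoch_ne hq n
  simp only [fW, qPoch_succ]
  field_simp
  ring

lemma fW_summable {q : ℂ} (hq : ‖q‖ < 1) (a : ℂ) : Summable fun n => ‖fW q a n‖ := by
  refine summable_ratio hq (u := fun n => a * q ^ (2 * n + 1)) ?_ (fW_succ hq a)
  have := ((tendsto_q_mul hq (m := 2) (by norm_num)).const_mul (a * q))
  simp only [mul_zero] at this
  refine this.congr fun n => ?_
  ring

lemma fW_shift (q a : ℂ) (N n : ℕ) : fW q (a * q ^ N) n = fW q a n * q ^ (N * n) := by
  simp only [fW, mul_pow, ← pow_mul]; ring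

noncomputable def FW (q a : ℂ) : ℂ := ∑' n, fW q a n

lemma FW_rec {q : ℂ} (hq : ‖q‖ < 1) (a : ℂ) :
    FW q a = FW q (a * q ^ 1) + a * q * FW q (a * q ^ 2) := by
  have s := fun b => (fW_summable hq b).of_norm
  have h1 : FW q a - FW q (a * q ^ 1) = ∑' n, (fW q a n - fW q (a * q ^ 1) n) :=
    ((s a).tsum_sub (s _)).symm
  rw [((s a).sub (s _)).tsum_eq_zero_add] at h1
  have h2 : ∀ n, fW q a (n + 1) - fW q (a * q ^ 1) (n + 1) = a * q * fW q (a * q ^ 2) n := by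
    intro n
    rw [fW_shift, fW_shift]
    have := fW_succ hq a n
    linear_combination this
  simp only [h2, tsum_mul_left] at h1
  rw [fW_shift] at h1
  simp only [FW] at *
  linear_combination h1

lemma FW_tendsto {q : ℂ} (hq : ‖q‖ < 1) (a : ℂ) :
    Tendsto (fun N : ℕ => FW q (a * q ^ N)) atTop (𝓝 1) := by
  have := tendsto_tsum_of_dominated_convergence (𝓕 := atTop)
    (f := fun N n : ℕ => fW q (a * q ^ N) n)
    (g := fun n : ℕ => if n = 0 then (1 : ℂ) else 0) (fW_summable hq a) ?_ ?_
  · simpa [FW] using this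
  · intro k
    rcases eq_or_ne k 0 with rfl | hk
    · simp [fW, qPoch]
    · simp only [fW_shift, hk, if_false]
      simpa using (tendsto_q_mul hq hk).const_mul (fW q a k)
  · refine Eventually.of_forall fun N k => ?_
    rw [fW_shift, norm_mul, norm_pow]
    exact mul_le_of_le_one_right (norm_nonneg _) (pow_le_one₀ (norm_nonneg _) hq.le)

noncomputable def gW (q a : ℂ) (n : ℕ) : ℂ := cW q a n * (q ^ (2 * n) * (1 - a * q ^ (2 * n))) * PW q a n
noncomputable def lW (q a : ℂ) (n : ℕ) : ℂ :=
  cW q a n * (q ^ n * (1 - a ^ 2 * q ^ (4 * n))) * PW q a n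
noncomputable def GW (q a : ℂ) : ℂ := ∑' n, gW q a n
noncomputable def LW (q a : ℂ) : ℂ := ∑' n, lW q a n

lemma q_pow_le {q : ℂ} (hq : ‖q‖ < 1) (n : ℕ) : ‖q ^ n‖ ≤ 1 := by
  rw [norm_pow]; exact pow_le_one₀ (norm_nonneg _) hq.le

lemma one_sub_le {q : ℂ} (hq : ‖q‖ < 1) (a : ℂ) (m n : ℕ) :
    ‖q ^ m * (1 - a * q ^ n)‖ ≤ 1 + ‖a‖ := by
  rw [norm_mul]
  have h1 := q_pow_le hq m
  have h2 := q_pow_le hq n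
  have h3 : ‖1 - a * q ^ n‖ ≤ 1 + ‖a‖ := by
    refine (norm_sub_le _ _).trans ?_
    rw [norm_one, norm_mul]
    gcongr
    exact mul_le_of_le_one_right (norm_nonneg _) h2
  exact (mul_le_of_le_one_left (norm_nonneg _) h1).trans h3

lemma summable_aux {q : ℂ} (hq : ‖q‖ < 1) {a : ℂ} (ha : ∀ j : ℕ, a * q ^ j ≠ 1) {w : ℕ → ℂ}
    {C : ℝ} (hw : ∀ n, ‖w n‖ ≤ C) : Summable fun n => ‖cW q a n * w n * PW q a n‖ := by
  obtain ⟨B, hB0, hB⟩ := PW_bdd hq ha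
  have hC : 0 ≤ C := (norm_nonneg _).trans (hw 0)
  refine Summable.of_nonneg_of_le (fun _ => norm_nonneg _) (fun n => ?_)
    ((cW_summable hq a).mul_right (C * B))
  rw [norm_mul, norm_mul, mul_assoc]
  have h1 := hw n
  have h2 := hB n
  gcongr

lemma gW_summable {q : ℂ} (hq : ‖q‖ < 1) {a : ℂ} (ha : ∀ j : ℕ, a * q ^ j ≠ 1) :
    Summable fun n => ‖gW q a n‖ :=
  summable_aux hq ha fun n => one_sub_le hq a (2 * n) (2 * n)

lemma lW_summable {q : ℂ} (hq : ‖q‖ < 1) {a : ℂ} (ha : ∀ j : ℕ, a * q ^ j ≠ 1) :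
    Summable fun n => ‖lW q a n‖ :=
  summable_aux hq ha fun n => one_sub_le hq (a ^ 2) n (4 * n)

lemma aW_summable {q : ℂ} (hq : ‖q‖ < 1) {a : ℂ} (ha : ∀ j : ℕ, a * q ^ j ≠ 1) (m : ℕ) :
    Summable fun n => cW q a n * (q ^ (m * n) * (1 - 1 * q ^ n)) * PW q a n :=
  (summable_aux hq ha fun n => one_sub_le hq 1 (m * n) n).of_norm

lemma GW_eq {q : ℂ} (hq : ‖q‖ < 1) {a : ℂ} (ha : ∀ j : ℕ, a * q ^ j ≠ 1) :
    GW q a = LW q (a * q ^ 1) := by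
  have s1 := (gW_summable hq ha).of_norm
  have s2 := (lW_summable hq (ha_shift ha 1)).of_norm
  have s3 := aW_summable hq ha 2
  have h := s3.tsum_eq_zero_add
  have h0 := (s1.sub s3).tsum_add ((summable_nat_add_iff 1).2 s3)
  rw [s1.tsum_sub s3] at h0
  unfold GW LW
  have e : ∑' n, lW q (a * q ^ 1) n = ∑' b, (gW q a b - cW q a b * (q ^ (2 * b) * (1 - 1 * q ^ b)) * PW q a b +
      cW q a (b + 1) * (q ^ (2 * (b + 1)) * (1 - 1 * q ^ (b + 1))) * PW q a (b + 1)) := by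
    refine tsum_congr fun n => ?_
    have h1 := cW_succ hq a n
    have h2 := PW_succ hq ha n
    simp only [lW, gW, PW_shift, cW_shift]
    rw [add_comm 1 n]
    linear_combination (-q ^ (2 * (n + 1)) * PW q a (n + 1)) * h1 - cW q a n * q ^ (3 * n) * h2
  rw [e, h0, h]
  simp

lemma LW_eq {q : ℂ} (hq : ‖q‖ < 1) {a : ℂ} (ha : ∀ j : ℕ, a * q ^ j ≠ 1) :
    LW q a = GW q a + a * GW q (a * q ^ 1) := by
  have s1 := (gW_summable hq ha).of_norm
  have s2 := (lW_summable hq ha).of_norm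
  have s4 := (gW_summable hq (ha_shift ha 1)).of_norm
  have s3 := aW_summable hq ha 1
  have h := s3.tsum_eq_zero_add
  have h0 := ((s2.sub s1).sub s3).tsum_add ((summable_nat_add_iff 1).2 s3)
  rw [(s2.sub s1).tsum_sub s3, s2.tsum_sub s1] at h0
  unfold GW LW
  have e : a * ∑' n, gW q (a * q ^ 1) n = ∑' b, (lW q a b - gW q a b - cW q a b * (q ^ (1 * b) * (1 - 1 * q ^ b)) * PW q a b +
      cW q a (b + 1) * (q ^ (1 * (b + 1)) * (1 - 1 * q ^ (b + 1))) * PW q a (b + 1)) := by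
    rw [← tsum_mul_left]
    refine tsum_congr fun n => ?_
    have h1 := cW_succ hq a n
    have h2 := PW_succ hq ha n
    simp only [lW, gW, PW_shift, cW_shift]
    rw [add_comm 1 n]
    linear_combination (-q ^ (1 * (n + 1)) * PW q a (n + 1)) * h1 - a * cW q a n * q ^ (4 * n) * h2
  rw [e, h0, h]
  simp

lemma GW_rec {q : ℂ} (hq : ‖q‖ < 1) {a : ℂ} (ha : ∀ j : ℕ, a * q ^ j ≠ 1) :
    GW q a = GW q (a * q ^ 1) + a * q * GW q (a * q ^ 2) := by
  rw [GW_eq hq ha, LW_eq hq (ha_shift ha 1)]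
  rw [show a * q ^ 1 * q ^ 1 = a * q ^ 2 by ring, pow_one]

lemma GW_tendsto {q : ℂ} (hq : ‖q‖ < 1) {a : ℂ} (ha : ∀ j : ℕ, a * q ^ j ≠ 1) :
    Tendsto (fun N : ℕ => GW q (a * q ^ N)) atTop (𝓝 1) := by
  obtain ⟨B, hB0, hB⟩ := PW_bdd hq ha
  have key : ∀ N k, ‖gW q (a * q ^ N) k‖ ≤ ‖cW q a k‖ * (‖q ^ (N * (2 * k))‖ * ((1 + ‖a‖) * B)) := by
    intro N k
    have h1 : ‖q ^ (2 * k) * (1 - a * q ^ N * q ^ (2 * k))‖ ≤ 1 + ‖a‖ := by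
      rw [mul_assoc a, ← pow_add]; exact one_sub_le hq _ _ _
    have h2 := hB (N + k)
    rw [gW, PW_shift, cW_shift, norm_mul, norm_mul, norm_mul, mul_assoc, mul_assoc]
    gcongr
  have := tendsto_tsum_of_dominated_convergence (𝓕 := atTop)
    (f := fun N n : ℕ => gW q (a * q ^ N) n)
    (g := fun n : ℕ => if n = 0 then (1 : ℂ) else 0)
    ((cW_summable hq a).mul_right ((1 + ‖a‖) * B)) ?_ ?_
  · simpa [GW] using this
  · intro k
    rcases eq_or_ne k 0 with rfl | hk
    · have h := (((tendsto_q hq).const_mul a).const_sub 1).mul (PW_tendsto hq ha)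
      simpa [gW, cW, qPoch, PW_shift] using h
    · simp only [hk, if_false]
      refine squeeze_zero_norm (key · k) ?_
      have := (((tendsto_q_mul hq (m := 2 * k) (by omega)).norm).mul_const ((1 + ‖a‖) * B)).const_mul ‖cW q a k‖
      simpa using this
  · refine Eventually.of_forall fun N k => (key N k).trans ?_
    have hn : 0 ≤ (1 + ‖a‖) * B := mul_nonneg (by positivity) hB0
    exact mul_le_mul_of_nonneg_left (mul_le_of_le_one_left hn (q_pow_le hq _)) (norm_nonneg _)

lemma rec_zero {q : ℂ} (hq : ‖q‖ < 1) (a : ℂ) (D : ℕ → ℂ) (hD : Tendsto D atTop (𝓝 0))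
    (h : ∀ n, D n = D (n + 1) + a * q ^ (n + 1) * D (n + 2)) : D 0 = 0 := by
  set M : ℕ → ℝ := fun n => max ‖D n‖ ‖D (n + 1)‖ with hM
  have hM0 : ∀ n, 0 ≤ M n := fun n => (norm_nonneg _).trans (le_max_left _ _)
  have hMt : Tendsto M atTop (𝓝 0) := by
    have := hD.norm.max ((tendsto_add_atTop_iff_nat 1).2 hD).norm
    simpa using this
  have s : Summable fun n : ℕ => ‖a‖ * ‖q‖ ^ (n + 1) :=
    ((summable_nat_add_iff 1).2 (summable_geometric_of_lt_one (norm_nonneg _) hq)).mul_left _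
  have step : ∀ n, M n ≤ (1 + ‖a‖ * ‖q‖ ^ (n + 1)) * M (n + 1) := by
    intro n
    have h1 : ‖D (n + 1)‖ ≤ M (n + 1) := le_max_left _ _
    have h2 : ‖D (n + 2)‖ ≤ M (n + 1) := le_max_right _ _
    have h3 : 0 ≤ ‖a‖ * ‖q‖ ^ (n + 1) := by positivity
    refine max_le ?_ ?_
    · rw [h n]
      refine (norm_add_le _ _).trans ?_
      rw [norm_mul, norm_mul, norm_pow, add_mul, one_mul]
      gcongr
    · nlinarith [hM0 (n + 1), mul_nonneg h3 (hM0 (n + 1))]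
  have bound : ∀ n, M 0 ≤ (∏ i ∈ Finset.range n, (1 + ‖a‖ * ‖q‖ ^ (i + 1))) * M n := by
    intro n
    induction n with
    | zero => simp
    | succ n ih =>
      refine ih.trans ?_
      rw [Finset.prod_range_succ, mul_assoc]
      have := step n
      gcongr
  have m : Multipliable fun i : ℕ => 1 + ‖a‖ * ‖q‖ ^ (i + 1) :=
    multipliable_one_add_of_summable s.norm
  have lim := m.tendsto_prod_tprod_nat.mul hMt
  rw [mul_zero] at lim
  have : M 0 ≤ 0 := ge_of_tendsto' lim bound
  have h0 : ‖D 0‖ ≤ M 0 := le_max_left _ _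
  exact norm_le_zero_iff.1 (h0.trans this)

lemma GW_eq_FW {q : ℂ} (hq : ‖q‖ < 1) {a : ℂ} (ha : ∀ j : ℕ, a * q ^ j ≠ 1) :
    GW q a = FW q a := by
  have := rec_zero hq a (fun n => GW q (a * q ^ n) - FW q (a * q ^ n))
    (by simpa using (GW_tendsto hq ha).sub (FW_tendsto hq a)) (fun n => ?_)
  · simpa [sub_eq_zero] using this
  · have h1 := GW_rec hq (ha_shift ha n)
    have h2 := FW_rec hq (a * q ^ n)
    simp only [mul_assoc, ← pow_add, ← pow_succ] at h1 h2 ⊢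
    linear_combination h1 - h2

lemma exp_eq (k : ℕ) : k * (5 * k - 1) / 2 = 5 * k.choose 2 + 2 * k := by
  have h : k * (5 * k - 1) = 2 * (5 * k.choose 2 + 2 * k) := by
    induction k with
    | zero => simp
    | succ n ih =>
      rw [choose_succ_two]
      rcases n with _ | n
      · simp
      · rw [show 5 * (n + 1) - 1 = 5 * n + 4 by omega] at ih
        rw [show 5 * (n + 1 + 1) - 1 = 5 * n + 9 by omega]
        nlinarith
  omega

/-- Watson's identity. -/
theorem watson_identity (q a : ℂ) (hq : ‖q‖ < 1) (ha : ∀ j : ℕ, a * q ^ j ≠ 1) :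
    Summable (fun k : ℕ =>
      ‖(-1 : ℂ) ^ k * (1 - a * q ^ (2 * k)) / (qPoch q q k * qPochInf q (a * q ^ k)) *
        a ^ (2 * k) * q ^ (k * (5 * k - 1) / 2)‖) ∧
    Summable (fun n : ℕ => ‖a ^ n * q ^ (n ^ 2) / qPoch q q n‖) ∧
    (∑' k : ℕ, (-1 : ℂ) ^ k * (1 - a * q ^ (2 * k)) /
        (qPoch q q k * qPochInf q (a * q ^ k)) * a ^ (2 * k) * q ^ (k * (5 * k - 1) / 2)) =
      ∑' n : ℕ, a ^ n * q ^ (n ^ 2) / qPoch q q n := by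
  have e : ∀ k : ℕ, (-1 : ℂ) ^ k * (1 - a * q ^ (2 * k)) /
        (qPoch q q k * qPochInf q (a * q ^ k)) * a ^ (2 * k) * q ^ (k * (5 * k - 1) / 2) =
        gW q a k := by
    intro k
    rw [exp_eq, gW, cW, PW, pow_add, div_eq_mul_inv, div_eq_mul_inv, mul_inv]
    ring
  simp only [e]
  exact ⟨gW_summable hq ha, fW_summable hq a, GW_eq_FW hq ha⟩
end

section
/- Schur's identity: Let q be a complex number with |q| < 1. Then (∏_{k=1}^∞ (1 − q^k)) · (∑_{n=0}^∞ q^{n²} / (q;q)_n) = ∑_{k=−∞}^∞ (−1)^k q^{k(5k−1)/2}, where the sum on the right runs over all integers k. -/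
theorem qp_succ (q : ℂ) (n : ℕ) : qPoch q q (n+1) = qPoch q q n * (1 - q^(n+1)) := by
  unfold qPoch; rw [Finset.prod_range_succ, pow_succ']

theorem qp_zero (q : ℂ) : qPoch q q 0 = 1 := by simp [qPoch]

theorem one_sub_ne (q : ℂ) (hq : ‖q‖ < 1) (n : ℕ) : 1 - q^(n+1) ≠ 0 := by
  intro h
  have h1 : q^(n+1) = 1 := (sub_eq_zero.mp h).symm
  have h2 : ‖q‖^(n+1) = 1 := by rw [← norm_pow, h1, norm_one]
  have h3 : ‖q‖^(n+1) < 1 := pow_lt_one₀ (norm_nonneg _) hq (by omega)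
  linarith

theorem qp_ne (q : ℂ) (hq : ‖q‖ < 1) (n : ℕ) : qPoch q q n ≠ 0 := by
  induction n with
  | zero => simp [qp_zero]
  | succ n ih => rw [qp_succ]; exact mul_ne_zero ih (one_sub_ne q hq n)

noncomputable def gb (q : ℂ) : ℕ → ℕ → ℂ
  | _, 0 => 1
  | 0, _ + 1 => 0
  | n + 1, i + 1 => gb q n i + q ^ (i + 1) * gb q n (i + 1)

theorem gb_zero (q : ℂ) (n : ℕ) : gb q n 0 = 1 := by cases n <;> rfl
theorem gb_succ (q : ℂ) (n i : ℕ) :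
    gb q (n+1) (i+1) = gb q n i + q ^ (i + 1) * gb q n (i + 1) := rfl

theorem gb_big (q : ℂ) (n : ℕ) : ∀ i, n < i → gb q n i = 0 := by
  induction n with
  | zero => intro i hi; cases i with
    | zero => omega
    | succ i => rfl
  | succ n ih => intro i hi; cases i with
    | zero => omega
    | succ i => rw [gb_succ, ih _ (by omega), ih _ (by omega)]; simp

theorem gb_mul (q : ℂ) (n : ℕ) :
    ∀ i m, i + m = n → gb q n i * qPoch q q i * qPoch q q m = qPoch q q n := by
  induction n with
  | zero => intro i m h
            obtain ⟨rfl, rfl⟩ : i = 0 ∧ m = 0 := by omega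
            simp [gb_zero, qp_zero]
  | succ n ih =>
    intro i m h
    cases i with
    | zero => obtain rfl : m = n+1 := by omega
              simp [gb_zero, qp_zero]
    | succ i =>
      rw [gb_succ]
      cases m with
      | zero =>
        obtain rfl : i = n := by omega
        have := ih i 0 (by omega)
        rw [qp_zero] at this
        rw [gb_big q i (i+1) (by omega), qp_succ, qp_zero]
        linear_combination (1 - q^(i+1)) * this
      | succ m =>
        have h1 := ih i (m+1) (by omega)
        have h2 := ih (i+1) m (by omega)
        have h3 : n + 1 = (i+1) + (m+1) := by omega
        rw [qp_succ q n, qp_succ q i, qp_succ q m]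
        rw [qp_succ] at h1 h2
        rw [h3, pow_add]
        linear_combination (1 - q^(i+1)) * h1 + q^(i+1) * (1 - q^(m+1)) * h2

theorem q_binom (q : ℂ) (n : ℕ) : ∀ x : ℂ,
    ∑ i ∈ Finset.range (n+1), x^i * q^(i.choose 2) * gb q n i
      = ∏ i ∈ Finset.range n, (1 + x * q^i) := by
  induction n with
  | zero => intro x; simp [gb_zero]
  | succ n ih =>
    intro x
    rw [Finset.prod_range_succ']
    have h : ∏ k ∈ Finset.range n, (1 + x * q^(k+1)) = ∏ k ∈ Finset.range n, (1 + (x*q) * q^k) :=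
      Finset.prod_congr rfl (fun k _ => by ring)
    rw [h, ← ih (x*q), Finset.sum_range_succ']
    simp only [gb_succ, gb_zero]
    have e1 : ∀ i ∈ Finset.range (n+1), x^(i+1) * q^((i+1).choose 2) * (gb q n i + q^(i+1) * gb q n (i+1))
      = x * ((x*q)^i * q^(i.choose 2) * gb q n i) + (x*q)^(i+1) * q^((i+1).choose 2) * gb q n (i+1) := by
      intro i _
      have : (i+1).choose 2 = i + i.choose 2 := by
        rw [Nat.choose_succ_succ' i 1, Nat.choose_one_right]
      rw [this, mul_pow, mul_pow, pow_add q i]; ring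
    rw [Finset.sum_congr rfl e1, Finset.sum_add_distrib, ← Finset.mul_sum]
    have e2 := Finset.sum_range_succ' (fun i => (x*q)^i * q^(i.choose 2) * gb q n i) (n+1)
    rw [Finset.sum_range_succ] at e2
    rw [gb_big q n (n+1) (by omega)] at e2
    simp only [gb_zero] at e2
    simp at e2 ⊢
    linear_combination -e2

theorem vand (q : ℂ) (hq : ‖q‖ < 1) (M : ℕ) : ∀ c : ℕ,
    ∑ j ∈ Finset.range (M+1), q^(j*(j+c)) * gb q M j / qPoch q q (j+c) = 1 / qPoch q q (M+c) := by
  induction M with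
  | zero => intro c; simp [gb_zero]
  | succ M ih =>
    intro c
    have h := ih (c+1)
    rw [show M + 1 + c = M + (c+1) by ring, ← h, Finset.sum_range_succ']
    have e1 : ∀ j ∈ Finset.range (M+1),
        q^((j+1)*(j+1+c)) * gb q (M+1) (j+1) / qPoch q q (j+1+c)
        = (q^(j*(j+(c+1))) * gb q M j / qPoch q q (j+(c+1)) - q^(j*(j+1+c)) * gb q M j / qPoch q q (j+c))
          + q^((j+1)*(j+1+1+c)) * gb q M (j+1) / qPoch q q (j+1+c) := by
      intro j _
      rw [gb_succ, show j+1+c = j+c+1 by ring, show j+(c+1) = j+c+1 by ring, qp_succ]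
      have a1 := qp_ne q hq (j+c)
      have a2 := one_sub_ne q hq (j+c)
      rw [show (j+1)*(j+c+1) = j*(j+c+1) + (j+c+1) by ring,
        show (j+1)*(j+1+1+c) = j*(j+c+1) + (j+c+1) + (j+1) by ring]
      field_simp
      ring
    rw [Finset.sum_congr rfl e1, Finset.sum_add_distrib, Finset.sum_sub_distrib]
    have e2 := Finset.sum_range_succ' (fun j => q^(j*(j+1+c)) * gb q M j / qPoch q q (j+c)) (M+1)
    rw [Finset.sum_range_succ] at e2
    rw [gb_big q M (M+1) (by omega)] at e2
    simp only [gb_zero] at e2 ⊢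
    simp at e2 ⊢
    linear_combination -e2

/-- `1/(q;q)_m`, extended by zero to negative `m`. -/
noncomputable def rr (q : ℂ) (m : ℤ) : ℂ := if m < 0 then 0 else (qPoch q q m.toNat)⁻¹

theorem rr_neg (q : ℂ) (m : ℤ) (h : m < 0) : rr q m = 0 := by simp [rr, h]
theorem rr_nat (q : ℂ) (m : ℤ) (n : ℕ) (h : m = n) : rr q m = (qPoch q q n)⁻¹ := by
  subst h; simp [rr]

theorem vand_nat (q : ℂ) (hq : ‖q‖ < 1) (M k : ℕ) :
    ∑ s ∈ Finset.range (M+k+1), q^(s^2) * rr q ((M+k:ℕ) - s) * (rr q (s - k) * rr q (s + k))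
      = q^(k^2) * (rr q ((M+k:ℕ) - k) * rr q ((M+k:ℕ) + k)) := by
  rw [show M + k + 1 = k + (M+1) by ring, Finset.sum_range_add, Finset.sum_eq_zero, zero_add]
  · have hv := vand q hq M (2*k)
    rw [rr_nat q _ M (by push_cast; ring), rr_nat q ((M+k:ℕ)+k) (M+2*k) (by push_cast; ring)]
    rw [← one_div (qPoch q q (M+2*k)), ← hv, Finset.mul_sum, Finset.mul_sum]
    refine Finset.sum_congr rfl fun j hj => ?_
    have hj' : j ≤ M := by simpa [Nat.lt_succ_iff] using hj
    obtain ⟨m, rfl⟩ := Nat.exists_eq_add_of_le hj'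
    rw [rr_nat q _ m (by push_cast; ring), rr_nat q _ j (by push_cast; ring),
      rr_nat q _ (j+2*k) (by push_cast; ring)]
    have hg := gb_mul q (j+m) j m rfl
    have h1 := qp_ne q hq j
    have h2 := qp_ne q hq m
    have h3 := qp_ne q hq (j+m)
    have h4 := qp_ne q hq (j+2*k)
    rw [show (k+j)^2 = k^2 + j*(j+2*k) by ring, pow_add]
    field_simp
    rw [← hg]; ring
  · intro s hs
    rw [rr_neg q (s-k) (by have := Finset.mem_range.mp hs; omega)]; simp

theorem vand_int (q : ℂ) (hq : ‖q‖ < 1) (N : ℕ) (k : ℤ) (hk : k ∈ Finset.Icc (-(N:ℤ)) N) :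
    ∑ s ∈ Finset.range (N+1), q^(s^2) * rr q (N - s) * (rr q (s - k) * rr q (s + k))
      = q^(k^2) * (rr q (N - k) * rr q (N + k)) := by
  rw [Finset.mem_Icc] at hk
  rcases Int.eq_nat_or_neg k with ⟨n, rfl | rfl⟩
  · obtain ⟨M, rfl⟩ : ∃ M, N = M + n := ⟨N - n, by omega⟩
    have := vand_nat q hq M n
    rw [this]; norm_cast
  · obtain ⟨M, rfl⟩ : ∃ M, N = M + n := ⟨N - n, by omega⟩
    have := vand_nat q hq M n
    simp only [sub_neg_eq_add, ← sub_eq_add_neg]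
    rw [mul_comm (rr q (((M+n:ℕ):ℤ)+n)), neg_sq]
    rw [show q^((n:ℤ)^2) = q^(n^2) by norm_cast, ← this]
    exact Finset.sum_congr rfl fun s _ => by ring

theorem bailey (q : ℂ) (hq : ‖q‖ < 1) (w : ℤ → ℂ) (N : ℕ) :
    ∑ k ∈ Finset.Icc (-(N:ℤ)) N, w k * q^(k^2) * (rr q (N - k) * rr q (N + k))
    = ∑ s ∈ Finset.range (N+1), q^(s^2) * rr q (N - s) *
        ∑ k ∈ Finset.Icc (-(s:ℤ)) s, w k * (rr q (s - k) * rr q (s + k)) := by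
  have h1 : ∀ s ∈ Finset.range (N+1), q^(s^2) * rr q (N - s) *
        ∑ k ∈ Finset.Icc (-(s:ℤ)) s, w k * (rr q (s - k) * rr q (s + k))
      = ∑ k ∈ Finset.Icc (-(N:ℤ)) N, w k * (q^(s^2) * rr q (N - s) * (rr q (s - k) * rr q (s + k))) := by
    intro s hs
    have hs' := Finset.mem_range.mp hs
    rw [Finset.sum_subset (s₂ := Finset.Icc (-(N:ℤ)) N), Finset.mul_sum]
    · exact Finset.sum_congr rfl fun k _ => by ring
    · exact Finset.Icc_subset_Icc (by omega) (by omega)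
    · intro k _ hk
      rw [Finset.mem_Icc, not_and_or] at hk
      rcases hk with hk | hk
      · rw [rr_neg q (s+k) (by omega)]; simp
      · rw [rr_neg q (s-k) (by omega)]; simp
  rw [Finset.sum_congr rfl h1, Finset.sum_comm]
  refine Finset.sum_congr rfl fun k hk => ?_
  rw [← Finset.mul_sum, vand_int q hq N k hk]; ring

theorem choose_two_int (i : ℕ) : ((i.choose 2 : ℕ) : ℤ) * 2 = i * (i - 1) := by
  induction i with
  | zero => simp
  | succ n ih =>
    rw [Nat.choose_succ_succ' n 1, Nat.choose_one_right]; push_cast; linarith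

theorem base (q : ℂ) (hq : ‖q‖ < 1) (h0 : q ≠ 0) (s : ℕ) (hs : 0 < s) :
    ∑ k ∈ Finset.Icc (-(s:ℤ)) s, (-1)^k * q^((k*(k-1))/2) * (rr q (s - k) * rr q (s + k)) = 0 := by
  have hb := q_binom q (2*s) (-(q⁻¹)^s)
  rw [Finset.prod_eq_zero (i := s) (by simp; omega)] at hb
  swap
  · rw [inv_pow, neg_mul, inv_mul_cancel₀ (pow_ne_zero _ h0)]; ring
  have key : ∑ k ∈ Finset.Icc (-(s:ℤ)) s, (-1)^k * q^((k*(k-1))/2) * (rr q (s - k) * rr q (s + k))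
    = ∑ i ∈ Finset.range (2*s+1), ((-1)^s * q^((s+1).choose 2) / qPoch q q (2*s)) *
       ((-(q⁻¹)^s)^i * q^(i.choose 2) * gb q (2*s) i) := by
    symm
    refine Finset.sum_bij (fun i _ => (i:ℤ) - s) ?_ ?_ ?_ ?_
    · intro i hi; simp at hi ⊢; omega
    · intro i _ j _ h; simpa using h
    · intro k hk
      rw [Finset.mem_Icc] at hk
      exact ⟨(k+s).toNat, by simp; omega, by omega⟩
    · intro i hi
      have hi' : i ≤ 2*s := by simpa [Nat.lt_succ_iff] using hi
      obtain ⟨m, hm⟩ := Nat.exists_eq_add_of_le hi'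
      rw [rr_nat q _ m (by omega), rr_nat q _ i (by omega)]
      have hg := gb_mul q (2*s) i m hm.symm
      have h1 := qp_ne q hq i
      have h2 := qp_ne q hq m
      have h3 := qp_ne q hq (2*s)
      have hsg : (-1:ℂ)^((i:ℤ)-s) = (-1)^s * (-1)^i := by
        rw [zpow_sub₀ (by norm_num), zpow_natCast, zpow_natCast, div_eq_iff (by simp)]
        rw [mul_right_comm, ← mul_pow]; simp
      have hex : (((i:ℤ)-s)*((i:ℤ)-s-1))/2 = ((s+1).choose 2 : ℕ) + (i.choose 2 : ℕ) - (s*i:ℕ) := by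
        have a1 := choose_two_int i
        have a2 := choose_two_int (s+1)
        apply Int.ediv_eq_of_eq_mul_left (by norm_num)
        push_cast at *
        linear_combination - a1 - a2
      rw [hsg, hex, zpow_sub₀ h0, zpow_add₀ h0, zpow_natCast, zpow_natCast, zpow_natCast,
        neg_pow (q⁻¹ ^ s) i, ← pow_mul, inv_pow]
      have h5 : q^(s*i) ≠ 0 := pow_ne_zero _ h0
      field_simp
      linear_combination hg
  rw [key, ← Finset.mul_sum, hb, mul_zero]

theorem finite_schur (q : ℂ) (hq : ‖q‖ < 1) (h0 : q ≠ 0) (N : ℕ) :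
    ∑ k ∈ Finset.Icc (-(N:ℤ)) N, (-1)^k * q^((k*(5*k-1))/2) * (rr q (N - k) * rr q (N + k))
    = ∑ s ∈ Finset.range (N+1), q^(s^2) / qPoch q q s * rr q (N - s) := by
  have hev : ∀ k : ℤ, ∃ t, k*(k-1) = 2*t := fun k => by
    obtain ⟨t, ht⟩ := Int.even_mul_pred_self k
    exact ⟨t, by rw [ht]; ring⟩
  have h1 : ∀ k : ℤ, (-1:ℂ)^k * q^((k*(5*k-1))/2)
      = ((-1)^k * q^((k*(k-1))/2) * q^(k^2)) * q^(k^2) := by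
    intro k
    obtain ⟨t, ht⟩ := hev k
    rw [show k*(5*k-1) = 2*(t + k^2 + k^2) by linear_combination ht, ht,
      Int.mul_ediv_cancel_left _ (by norm_num), Int.mul_ediv_cancel_left _ (by norm_num),
      zpow_add₀ h0, zpow_add₀ h0]; ring
  simp only [h1]
  rw [bailey q hq (fun k => (-1)^k * q^((k*(k-1))/2) * q^(k^2)) N]
  refine Finset.sum_congr rfl fun s _ => ?_
  rw [bailey q hq (fun k => (-1)^k * q^((k*(k-1))/2)) s, Finset.sum_eq_single 0]
  · simp [rr_nat q 0 0 rfl, rr_nat q s s rfl, qp_zero]; ring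
  · intro t _ ht
    rw [base q hq h0 t (by omega), mul_zero]
  · simp

open Filter Topology

theorem qp_tendsto (q : ℂ) (hq : ‖q‖ < 1) :
    Tendsto (fun n => qPoch q q n) atTop (𝓝 (∏' k : ℕ, (1 - q ^ (k + 1)))) := by
  have := (ModularForm.multipliable_one_sub_pow hq).hasProd.tendsto_prod_nat
  refine this.congr fun n => ?_
  exact Finset.prod_congr rfl fun k _ => by ring

theorem tprod_ne (q : ℂ) (hq : ‖q‖ < 1) : ∏' k : ℕ, (1 - q ^ (k + 1)) ≠ 0 := by
  simp only [sub_eq_add_neg]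
  refine tprod_one_add_ne_zero_of_summable (f := fun n : ℕ => -q^(n+1)) ?_ ?_
  · intro n; simpa [sub_eq_add_neg] using one_sub_ne q hq n
  · simp only [norm_neg, norm_pow]
    exact (summable_nat_add_iff 1).2 (summable_geometric_of_lt_one (norm_nonneg _) hq)

theorem rr_bound (q : ℂ) (hq : ‖q‖ < 1) : ∃ C : ℝ, 0 ≤ C ∧ ∀ m, ‖rr q m‖ ≤ C := by
  have h := Metric.isBounded_range_of_tendsto _ ((qp_tendsto q hq).inv₀ (tprod_ne q hq))
  obtain ⟨C, hC⟩ := h.exists_norm_le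
  have hC' : ∀ n, ‖(qPoch q q n)⁻¹‖ ≤ C := fun n => hC _ ⟨n, rfl⟩
  have h0 : 0 ≤ C := (norm_nonneg _).trans (hC' 0)
  refine ⟨C, h0, fun m => ?_⟩
  unfold rr
  split_ifs
  · simpa using h0
  · exact hC' _

theorem rr_tendsto (q : ℂ) (hq : ‖q‖ < 1) (k : ℤ) :
    Tendsto (fun N : ℕ => rr q (N + k)) atTop (𝓝 (∏' k : ℕ, (1 - q ^ (k + 1)))⁻¹) := by
  have h := (qp_tendsto q hq).inv₀ (tprod_ne q hq)
  have h2 : Tendsto (fun N : ℕ => ((N:ℤ) + k).toNat) atTop atTop := by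
    refine tendsto_atTop.2 fun b => ?_
    filter_upwards [eventually_ge_atTop (b + k.natAbs)] with N hN
    omega
  refine (h.comp h2).congr' ?_
  filter_upwards [eventually_ge_atTop k.natAbs] with N hN
  exact (rr_nat q _ _ (Int.toNat_of_nonneg (by omega)).symm).symm

theorem rr_tendsto_sub (q : ℂ) (hq : ‖q‖ < 1) (k : ℤ) :
    Tendsto (fun N : ℕ => rr q (N - k)) atTop (𝓝 (∏' k : ℕ, (1 - q ^ (k + 1)))⁻¹) :=
  rr_tendsto q hq (-k)

theorem summable_sq (q : ℂ) (hq : ‖q‖ < 1) : Summable (fun n : ℕ => ‖q‖^(n^2)) := by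
  refine Summable.of_nonneg_of_le (fun n => by positivity) (fun n => ?_)
    (summable_geometric_of_lt_one (norm_nonneg _) hq)
  exact pow_le_pow_of_le_one (norm_nonneg _) hq.le (by nlinarith)

theorem summable_theta (q : ℂ) (hq : ‖q‖ < 1) (h0 : q ≠ 0) :
    Summable (fun k : ℤ => ‖q‖^((k*(5*k-1))/2)) := by
  have hp : 0 < ‖q‖ := norm_pos_iff.2 h0
  have hb : ∀ k : ℤ, ‖q‖^((k*(5*k-1))/2) ≤ ‖q‖^(k.natAbs) := by
    intro k
    rw [← zpow_natCast]
    refine zpow_le_zpow_right_of_le_one₀ hp hq.le ?_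
    rw [Int.le_ediv_iff_mul_le (by norm_num)]
    rcases Int.eq_nat_or_neg k with ⟨n, rfl | rfl⟩
    · rcases Nat.eq_zero_or_pos n with rfl | hn
      · simp
      · simp; nlinarith
    · rcases Nat.eq_zero_or_pos n with rfl | hn
      · simp
      · simp; nlinarith
  refine Summable.of_nonneg_of_le (fun n => by positivity) hb ?_
  have hg := summable_geometric_of_lt_one (norm_nonneg _) hq
  exact Summable.of_nat_of_neg (by simpa using hg) (by simpa using hg)

/-- Schur's identity. -/
theorem schur_identity (q : ℂ) (hq : ‖q‖ < 1) :
    (∏' k : ℕ, (1 - q ^ (k + 1))) * (∑' n : ℕ, q ^ (n ^ 2) / qPoch q q n) =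
      ∑' k : ℤ, (-1 : ℂ) ^ k * q ^ ((k * (5 * k - 1)) / 2) := by
  by_cases h0 : q = 0
  · subst h0
    rw [tsum_eq_single 0, tsum_eq_single 0]
    · simp [qp_zero]
    · intro k hk
      rw [zero_zpow, mul_zero]
      have : 1 ≤ (k*(5*k-1))/2 := by
        rw [Int.le_ediv_iff_mul_le (by norm_num)]
        rcases lt_or_gt_of_ne hk with h | h <;> nlinarith
      omega
    · intro n hn
      rw [zero_pow (by positivity), zero_div]
  obtain ⟨C, hC0, hC⟩ := rr_bound q hq
  set L := ∏' k : ℕ, (1 - q ^ (k + 1)) with hL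
  have hLne : L ≠ 0 := tprod_ne q hq
  have t1 : Tendsto (fun N : ℕ => ∑' k : ℤ, (-1)^k * q^((k*(5*k-1))/2) * (rr q (N - k) * rr q (N + k)))
      atTop (𝓝 (∑' k : ℤ, (-1)^k * q^((k*(5*k-1))/2) * (L⁻¹ * L⁻¹))) := by
    refine tendsto_tsum_of_dominated_convergence
      (bound := fun k : ℤ => ‖q‖^((k*(5*k-1))/2) * (C * C))
      ((summable_theta q hq h0).mul_right _) ?_ ?_
    · intro k
      exact ((rr_tendsto_sub q hq k).mul (rr_tendsto q hq k)).const_mul _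
    · refine Eventually.of_forall fun N k => ?_
      rw [norm_mul, norm_mul, norm_mul, norm_zpow, norm_zpow, norm_neg, norm_one, one_zpow, one_mul]
      have := mul_le_mul (hC (N-k)) (hC (N+k)) (norm_nonneg _) hC0
      gcongr
  have t2 : Tendsto (fun N : ℕ => ∑' s : ℕ, q^(s^2) / qPoch q q s * rr q (N - s))
      atTop (𝓝 (∑' s : ℕ, q^(s^2) / qPoch q q s * L⁻¹)) := by
    refine tendsto_tsum_of_dominated_convergence
      (bound := fun s : ℕ => ‖q‖^(s^2) * (C * C))
      ((summable_sq q hq).mul_right _) ?_ ?_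
    · intro s
      exact (rr_tendsto_sub q hq s).const_mul _
    · refine Eventually.of_forall fun N s => ?_
      rw [div_eq_mul_inv, ← rr_nat q s s rfl, norm_mul, norm_mul, norm_pow, mul_assoc]
      have := mul_le_mul (hC s) (hC (N-s)) (norm_nonneg _) hC0
      gcongr
  have heq : (fun N : ℕ => ∑' k : ℤ, (-1)^k * q^((k*(5*k-1))/2) * (rr q (N - k) * rr q (N + k)))
      = (fun N : ℕ => ∑' s : ℕ, q^(s^2) / qPoch q q s * rr q (N - s)) := by
    funext N
    rw [tsum_eq_sum (s := Finset.Icc (-(N:ℤ)) N), tsum_eq_sum (s := Finset.range (N+1)),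
      finite_schur q hq h0 N]
    · intro s hs
      rw [rr_neg q _ (by simp at hs; omega), mul_zero]
    · intro k hk
      rw [Finset.mem_Icc, not_and_or] at hk
      rcases hk with hk | hk
      · rw [rr_neg q (N+k) (by omega)]; simp
      · rw [rr_neg q (N-k) (by omega)]; simp
  rw [heq] at t1
  have hfin := tendsto_nhds_unique t1 t2
  rw [tsum_mul_right, tsum_mul_right] at hfin
  field_simp at hfin
  rw [hfin]
end

section
/- The first Rogers–Ramanujan identity: Let q be a complex number with |q| < 1. Then ∑_{n=0}^∞ q^{n²} / (q;q)_n = ∏_{n=0}^∞ 1 / ((1 − q^{5n+1})(1 − q^{5n+4})). -/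
namespace RR

open Filter Topology

/-- Reciprocal of `(q;q)_n`. -/
noncomputable def r (q : ℂ) (n : ℕ) : ℂ := (qPoch q q n)⁻¹

/-- `1 / ((q)_{L-k} (q)_{L+k})`, zero for `k > L`. -/
noncomputable def b (q : ℂ) (L k : ℕ) : ℂ := if k ≤ L then r q (L - k) * r q (L + k) else 0

/-- Folded theta coefficients. -/
noncomputable def al (q x y : ℂ) (k : ℕ) : ℂ :=
  if k = 0 then 1 else (-1) ^ k * q ^ (k.choose 2) * (x ^ k + y ^ k)

lemma one_sub_pow_ne {q : ℂ} (hq : ‖q‖ < 1) (n : ℕ) : 1 - q ^ (n + 1) ≠ 0 := by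
  intro h
  have h1 : ‖q ^ (n + 1)‖ < 1 := by
    rw [norm_pow]; exact pow_lt_one₀ (norm_nonneg _) hq (by omega)
  rw [← sub_eq_zero.mp h] at h1
  simp at h1

lemma qPoch_succ (q a : ℂ) (n : ℕ) : qPoch q a (n + 1) = qPoch q a n * (1 - a * q ^ n) := by
  simp [qPoch, Finset.prod_range_succ]

lemma qPoch_zero (q a : ℂ) : qPoch q a 0 = 1 := by simp [qPoch]

lemma r_succ {q : ℂ} (hq : ‖q‖ < 1) (n : ℕ) : r q n = (1 - q ^ (n + 1)) * r q (n + 1) := by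
  have h := one_sub_pow_ne hq n
  rw [r, r, qPoch_succ, mul_inv, pow_succ', ← pow_succ'] 
  field_simp

lemma r_zero (q : ℂ) : r q 0 = 1 := by simp [r, qPoch]

lemma b_of_add (q : ℂ) (d k : ℕ) : b q (d + k) k = r q d * r q (d + k + k) := by
  simp [b]

lemma b_of_lt (q : ℂ) {L k : ℕ} (h : L < k) : b q L k = 0 := by
  simp [b, h]

/-- q-Vandermonde. -/
lemma vander {q : ℂ} (hq : ‖q‖ < 1) (N M : ℕ) :
    ∑ s ∈ Finset.range (N + 1), q ^ (s * (s + M)) * r q (N - s) * r q s * r q (s + M)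
      = r q N * r q (N + M) := by
  induction N generalizing M with
  | zero => simp [r_zero]
  | succ N ih =>
    have hne := one_sub_pow_ne hq N
    apply mul_left_cancel₀ hne
    have e : (1 - q ^ (N + 1)) * (r q (N + 1) * r q (N + 1 + M)) = r q N * r q (N + (M + 1)) := by
      rw [r_succ hq N, show N + (M + 1) = N + 1 + M by ring]; ring
    rw [e, ← ih (M + 1), Finset.mul_sum]
    have split : ∀ s ∈ Finset.range (N + 1 + 1),
        (1 - q ^ (N + 1)) * (q ^ (s * (s + M)) * r q (N + 1 - s) * r q s * r q (s + M))
        = (1 - q ^ s) * (q ^ (s * (s + M)) * r q (N + 1 - s) * r q s * r q (s + M))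
        + q ^ s * (1 - q ^ (N + 1 - s)) *
          (q ^ (s * (s + M)) * r q (N + 1 - s) * r q s * r q (s + M)) := by
      intro s hs
      have hs' : s ≤ N + 1 := by simpa [Nat.lt_succ_iff] using hs
      obtain ⟨d, hd⟩ := Nat.exists_eq_add_of_le hs'
      rw [hd, Nat.add_sub_cancel_left]; ring
    rw [Finset.sum_congr rfl split, Finset.sum_add_distrib, Finset.sum_range_succ' _ (N + 1),
      Finset.sum_range_succ _ (N + 1)]
    simp only [pow_zero, sub_self, zero_mul, mul_zero, add_zero, Nat.sub_self]
    rw [← Finset.sum_add_distrib]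
    apply Finset.sum_congr rfl
    intro s hs
    have hs' : s ≤ N := by simpa [Nat.lt_succ_iff] using hs
    obtain ⟨d, rfl⟩ := Nat.exists_eq_add_of_le hs'
    rw [show s + d + 1 - (s + 1) = d by omega, show s + d + 1 - s = d + 1 by omega,
      show s + d - s = d by omega, show s + 1 + M = s + M + 1 by ring, 
      show s + (M + 1) = s + M + 1 by ring, r_succ hq (s + M), r_succ hq d, r_succ hq s]
    ring

/-- the summed form used in the Bailey lemma -/
lemma bailey_inner {q : ℂ} (hq : ‖q‖ < 1) (L k : ℕ) :
    ∑ s ∈ Finset.range (L + 1), q ^ (s ^ 2) * r q (L - s) * b q s k = q ^ (k ^ 2) * b q L k := by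
  by_cases hk : k ≤ L
  · obtain ⟨N, rfl⟩ := Nat.exists_eq_add_of_le hk
    rw [add_assoc, Finset.sum_range_add]
    have h0 : ∑ s ∈ Finset.range k, q ^ (s ^ 2) * r q (k + N - s) * b q s k = 0 := by
      apply Finset.sum_eq_zero
      intro s hs
      rw [b_of_lt q (by simpa using hs), mul_zero]
    rw [h0, zero_add, add_comm k N, b_of_add, show N + k + k = N + 2 * k by ring,
      ← vander hq N (2 * k), Finset.mul_sum]
    apply Finset.sum_congr rfl
    intro s hs
    rw [show N + k - (k + s) = N - s by omega, add_comm k s, b_of_add,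
      show s + k + k = s + 2 * k by ring]
    ring
  · rw [b_of_lt q (by omega), mul_zero]
    apply Finset.sum_eq_zero
    intro s hs
    rw [b_of_lt q (by simp at hs; omega), mul_zero]

lemma bailey {q : ℂ} (hq : ‖q‖ < 1) (a : ℕ → ℂ) (L : ℕ) :
    ∑ s ∈ Finset.range (L + 1), q ^ (s ^ 2) * r q (L - s) *
        (∑ k ∈ Finset.range (s + 1), a k * b q s k)
      = ∑ k ∈ Finset.range (L + 1), (a k * q ^ (k ^ 2)) * b q L k := by
  have h : ∀ s ∈ Finset.range (L + 1), q ^ (s ^ 2) * r q (L - s) *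
        (∑ k ∈ Finset.range (s + 1), a k * b q s k)
        = ∑ k ∈ Finset.range (L + 1), a k * (q ^ (s ^ 2) * r q (L - s) * b q s k) := by
    intro s hs
    rw [Finset.mul_sum]
    rw [← Finset.sum_subset (s₁ := Finset.range (s + 1)) (s₂ := Finset.range (L + 1))]
    · apply Finset.sum_congr rfl
      intro k _
      ring
    · intro k hk
      simp at hs hk ⊢
      omega
    · intro k _ hk
      rw [b_of_lt q (by simp at hk; omega)]
      ring
  rw [Finset.sum_congr rfl h, Finset.sum_comm]
  apply Finset.sum_congr rfl
  intro k _
  rw [← Finset.mul_sum, bailey_inner hq]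
  ring

lemma b_rec {q : ℂ} (hq : ‖q‖ < 1) (L j : ℕ) :
    (1 - q ^ (2 * L + 1)) * (1 - q ^ (2 * L + 2)) * q ^ j * b q (L + 1) (j + 1)
      = q ^ j * (1 + q ^ (2 * L + 1)) * b q L (j + 1) + q ^ L * b q L j
        + q ^ (L + 2 * j + 2) * b q L (j + 2) := by
  rcases lt_trichotomy (j + 1) L with h | h | h
  · obtain ⟨d, rfl⟩ := Nat.exists_eq_add_of_le' (show j + 2 ≤ L from h)
    have e1 : b q (d + (j + 2) + 1) (j + 1) = r q (d + 2) * r q (2 * j + d + 4) := by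
      rw [show d + (j + 2) + 1 = (d + 2) + (j + 1) by ring, b_of_add]; congr 2; ring
    have e2 : b q (d + (j + 2)) (j + 1) = r q (d + 1) * r q (2 * j + d + 3) := by
      rw [show d + (j + 2) = (d + 1) + (j + 1) by ring, b_of_add]; congr 2; ring
    have e3 : b q (d + (j + 2)) j = r q (d + 2) * r q (2 * j + d + 2) := by
      rw [show d + (j + 2) = (d + 2) + j by ring, b_of_add]; congr 2; ring
    have e4 : b q (d + (j + 2)) (j + 2) = r q d * r q (2 * j + d + 4) := by
      rw [b_of_add]; congr 2; ring
    rw [e1, e2, e3, e4, r_succ hq d, r_succ hq (d + 1), r_succ hq (2 * j + d + 2),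
      r_succ hq (2 * j + d + 3)]
    ring
  · subst h
    have e1 : b q (j + 1 + 1) (j + 1) = r q 1 * r q (2 * j + 3) := by
      rw [show j + 1 + 1 = 1 + (j + 1) by ring, b_of_add]; congr 2; ring
    have e2 : b q (j + 1) (j + 1) = r q 0 * r q (2 * j + 2) := by
      simp [b]; left; congr 1; ring
    have e3 : b q (j + 1) j = r q 1 * r q (2 * j + 1) := by
      rw [show j + 1 = 1 + j by ring, b_of_add]; congr 2; ring
    rw [e1, e2, e3, b_of_lt q (show j + 1 < j + 2 by omega), r_succ hq 0,
      r_succ hq (2 * j + 1), r_succ hq (2 * j + 2)]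
    ring
  · rw [b_of_lt q h, b_of_lt q (show L < j + 2 by omega)]
    rcases Nat.lt_or_ge L j with h' | h'
    · rw [b_of_lt q h', b_of_lt q (show L + 1 < j + 1 by omega)]; ring
    · obtain rfl : L = j := by omega
      have e1 : b q (L + 1) (L + 1) = r q 0 * r q (2 * L + 2) := by
        simp [b]; left; congr 1; ring
      have e2 : b q L L = r q 0 * r q (2 * L) := by
        simp [b]; left; congr 1; ring
      rw [e1, e2, r_succ hq (2 * L), r_succ hq (2 * L + 1)]
      ring

lemma b_rec0 {q : ℂ} (hq : ‖q‖ < 1) (L : ℕ) :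
    (1 - q ^ (2 * L + 1)) * (1 - q ^ (2 * L + 2)) * b q (L + 1) 0
      = (1 + q ^ (2 * L + 1)) * b q L 0 + 2 * q ^ (L + 1) * b q L 1 := by
  rcases L with _ | L
  · rw [b_of_lt q (show 0 < 1 by omega)]
    simp only [b]
    simp [r_zero]
    have h := r_succ hq 0
    simp [r_zero] at h
    linear_combination (-(1 + q) * (1 + (1 - q) * r q 1)) * h
  · have e : b q (L + 1) 1 = r q L * r q (L + 2) := by rw [b_of_add]
    rw [e]
    simp only [b]
    simp
    rw [r_succ hq L, r_succ hq (L + 1)]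
    ring

lemma al_zero (q x y : ℂ) : al q x y 0 = 1 := by simp [al]

lemma al_succ (q x y : ℂ) (k : ℕ) : al q x y (k + 1) =
    (-1) ^ (k + 1) * q ^ ((k + 1).choose 2) * (x ^ (k + 1) + y ^ (k + 1)) := by simp [al]

lemma tele {q x y : ℂ} (hq : ‖q‖ < 1) (hxy : x * y = q) (L K : ℕ) :
    ∑ k ∈ Finset.range (K + 1), al q x y k *
      ((1 - q ^ (2 * L + 1)) * (1 - q ^ (2 * L + 2)) * b q (L + 1) k
        - (1 - x * q ^ L) * (1 - y * q ^ L) * b q L k)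
    = (-1) ^ K * q ^ (K.choose 2) * (x ^ K + y ^ K) * q ^ (L + 1 + K) * b q L (K + 1)
      + q ^ L * ((-1) ^ K * q ^ (K.choose 2)) * (x ^ (K + 1) + y ^ (K + 1)) * b q L K := by
  have hP : (1 - x * q ^ L) * (1 - y * q ^ L) = 1 + q ^ (2 * L + 1) - q ^ L * (x + y) := by
    rw [pow_succ, pow_mul, ← hxy]; ring
  rw [hP]
  induction K with
  | zero =>
    simp [al_zero]
    have := b_rec0 hq L
    linear_combination this
  | succ K ih =>
    rw [Finset.sum_range_succ, ih, al_succ]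
    have hc : (K + 1).choose 2 = K + K.choose 2 := by
      rw [Nat.choose_succ_succ' K 1, Nat.choose_one_right]
    rw [hc]
    have := b_rec hq L K
    have hu : (x ^ (K + 1) + y ^ (K + 1)) * (x + y)
        = x ^ (K + 2) + y ^ (K + 2) + q * (x ^ K + y ^ K) := by
      rw [← hxy]; ring
    rw [pow_add q K]
    linear_combination (-(-1) ^ K * q ^ (K.choose 2) * (x ^ (K + 1) + y ^ (K + 1))) * this
      - (-1) ^ K * q ^ (K.choose 2) * q ^ K * q ^ L * b q L (K + 1) * hu

/-- Finite Jacobi triple product. -/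
lemma fjtp {q x y : ℂ} (hq : ‖q‖ < 1) (hxy : x * y = q) (L : ℕ) :
    ∑ k ∈ Finset.range (L + 1), al q x y k * b q L k
      = qPoch q x L * qPoch q y L * r q (2 * L) := by
  induction L with
  | zero => simp [al_zero, b, r_zero, qPoch]
  | succ L ih =>
    have t := tele hq hxy L (L + 1)
    rw [b_of_lt q (show L < L + 1 + 1 by omega), b_of_lt q (show L < L + 1 by omega)] at t
    simp only [mul_sub (al q x y _), Finset.sum_sub_distrib, mul_zero, add_zero] at t
    rw [sub_eq_zero, Finset.sum_range_succ (fun k => al q x y k *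
      ((1 - x * q ^ L) * (1 - y * q ^ L) * b q L k)),
      b_of_lt q (show L < L + 1 by omega), mul_zero, mul_zero, add_zero] at t
    have h1 := one_sub_pow_ne hq (2 * L)
    have h2 := one_sub_pow_ne hq (2 * L + 1)
    apply mul_left_cancel₀ (mul_ne_zero h1 h2)
    rw [Finset.mul_sum]
    have t2 : ∑ k ∈ Finset.range (L + 1), al q x y k *
      ((1 - x * q ^ L) * (1 - y * q ^ L) * b q L k) = (1 - x * q ^ L) * (1 - y * q ^ L) *
        (qPoch q x L * qPoch q y L * r q (2 * L)) := by
      rw [← ih, Finset.mul_sum]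
      exact Finset.sum_congr rfl fun k _ => by ring
    rw [t2] at t
    rw [r_succ hq (2 * L), r_succ hq (2 * L + 1)] at t
    rw [qPoch_succ, qPoch_succ, show 2 * (L + 1) = 2 * L + 1 + 1 by ring]
    refine Eq.trans (Finset.sum_congr rfl fun k _ => ?_) (t.trans ?_)
    · ring
    · ring

lemma unit_pair {q : ℂ} (hq : ‖q‖ < 1) (L : ℕ) :
    ∑ k ∈ Finset.range (L + 1), al q 1 q k * b q L k = if L = 0 then 1 else 0 := by
  rw [fjtp hq (one_mul q)]
  rcases L with _ | L
  · simp [qPoch, r_zero]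
  · have : qPoch q 1 (L + 1) = 0 := by
      simp [qPoch, Finset.prod_range_succ']
    simp [this]

lemma pair1 {q : ℂ} (hq : ‖q‖ < 1) (L : ℕ) :
    ∑ k ∈ Finset.range (L + 1), (al q 1 q k * q ^ (k ^ 2)) * b q L k = r q L := by
  rw [← bailey hq]
  simp only [unit_pair hq]
  simp

lemma al_conv (q : ℂ) (k : ℕ) :
    al q 1 q k * q ^ (k ^ 2) * q ^ (k ^ 2) = al (q ^ 5) (q ^ 2) (q ^ 3) k := by
  rcases k with _ | k
  · simp [al]
  · rw [al_succ, al_succ]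
    have hc : 2 * (k + 1).choose 2 = (k + 1) * k := by
      rw [Nat.choose_two_right, Nat.add_sub_cancel, Nat.mul_div_cancel']
      exact (Nat.even_mul_pred_self (k + 1)).two_dvd
    have e : (q ^ 5) ^ ((k + 1).choose 2) = q ^ ((k + 1).choose 2) * q ^ (2 * ((k + 1) * k)) := by
      rw [← hc]; ring
    rw [e]; ring

lemma pair2 {q : ℂ} (hq : ‖q‖ < 1) (L : ℕ) :
    ∑ s ∈ Finset.range (L + 1), q ^ (s ^ 2) * r q (L - s) * r q s
    = ∑ k ∈ Finset.range (L + 1), al (q ^ 5) (q ^ 2) (q ^ 3) k * b q L k := by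
  simp only [← al_conv]
  rw [← bailey hq]
  simp only [pair1 hq]

/-- The infinite q-Pochhammer symbol. -/
noncomputable def qinf (q a : ℂ) : ℂ := ∏' i : ℕ, (1 - a * q ^ i)

lemma summ_norm {q : ℂ} (hq : ‖q‖ < 1) (a : ℂ) : Summable fun i : ℕ => ‖-(a * q ^ i)‖ := by
  simp only [norm_neg, norm_mul, norm_pow]
  exact (summable_geometric_of_lt_one (norm_nonneg _) hq).mul_left _

lemma mult_q {q : ℂ} (hq : ‖q‖ < 1) (a : ℂ) : Multipliable fun i : ℕ => 1 - a * q ^ i := by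
  simpa [sub_eq_add_neg] using multipliable_one_add_of_summable (summ_norm hq a)

lemma tendsto_qPoch {q : ℂ} (hq : ‖q‖ < 1) (a : ℂ) :
    Tendsto (qPoch q a) atTop (𝓝 (qinf q a)) :=
  (mult_q hq a).hasProd.tendsto_prod_nat

lemma qinf_ne {q : ℂ} (hq : ‖q‖ < 1) {a : ℂ} (ha : ‖a‖ < 1) : qinf q a ≠ 0 := by
  have := tprod_one_add_ne_zero_of_summable (f := fun i : ℕ => -(a * q ^ i)) ?_ (summ_norm hq a)
  · simpa [qinf, sub_eq_add_neg] using this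
  · intro i h
    have h1 : ‖a * q ^ i‖ < 1 := by
      rw [norm_mul, norm_pow]
      calc ‖a‖ * ‖q‖ ^ i ≤ ‖a‖ * 1 := by
            gcongr; exact pow_le_one₀ (norm_nonneg _) hq.le
        _ < 1 := by simpa using ha
    have h2 : a * q ^ i = 1 := by linear_combination -h
    rw [h2] at h1
    simp at h1

lemma tendsto_r {q : ℂ} (hq : ‖q‖ < 1) : Tendsto (r q) atTop (𝓝 (qinf q q)⁻¹) :=
  (tendsto_qPoch hq q).inv₀ (qinf_ne hq hq)

lemma r_bdd {q : ℂ} (hq : ‖q‖ < 1) : ∃ C : ℝ, 0 ≤ C ∧ ∀ n, ‖r q n‖ ≤ C := by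
  obtain ⟨C, hC⟩ := (tendsto_r hq).norm.bddAbove_range
  have h : ∀ n, ‖r q n‖ ≤ C := fun n => hC ⟨n, rfl⟩
  exact ⟨C, (norm_nonneg _).trans (h 0), h⟩

lemma lim_b {q : ℂ} (hq : ‖q‖ < 1) {a : ℕ → ℂ} (ha : Summable fun k => ‖a k‖) :
    Tendsto (fun L => ∑ k ∈ Finset.range (L + 1), a k * b q L k) atTop
      (𝓝 ((∑' k, a k) * ((qinf q q)⁻¹ * (qinf q q)⁻¹))) := by
  obtain ⟨C, hC0, hC⟩ := r_bdd hq
  have e : ∀ L, ∑ k ∈ Finset.range (L + 1), a k * b q L k = ∑' k, a k * b q L k := by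
    intro L
    rw [tsum_eq_sum]
    intro k hk
    rw [b_of_lt q (by simp at hk; omega), mul_zero]
  simp only [e]
  rw [← tsum_mul_right]
  apply tendsto_tsum_of_dominated_convergence (bound := fun k => ‖a k‖ * (C * C)) (ha.mul_right _)
  · intro k
    apply Tendsto.const_mul
    have h1 : Tendsto (fun L => r q (L - k) * r q (L + k)) atTop
        (𝓝 ((qinf q q)⁻¹ * (qinf q q)⁻¹)) :=
      ((tendsto_r hq).comp (tendsto_sub_atTop_nat k)).mul
        ((tendsto_r hq).comp (tendsto_add_atTop_nat k))
    refine h1.congr' ?_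
    filter_upwards [eventually_ge_atTop k] with L hL
    simp [b, hL]
  · refine Eventually.of_forall fun L k => ?_
    rw [norm_mul]
    gcongr
    unfold b
    split_ifs
    · rw [norm_mul]
      exact mul_le_mul (hC _) (hC _) (norm_nonneg _) hC0
    · simp; positivity

lemma lim_s {q : ℂ} (hq : ‖q‖ < 1) :
    Tendsto (fun L => ∑ s ∈ Finset.range (L + 1), q ^ (s ^ 2) * r q (L - s) * r q s) atTop
      (𝓝 ((∑' s : ℕ, q ^ (s ^ 2) * r q s) * (qinf q q)⁻¹)) := by
  obtain ⟨C, hC0, hC⟩ := r_bdd hq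
  have e : ∀ L, ∑ s ∈ Finset.range (L + 1), q ^ (s ^ 2) * r q (L - s) * r q s
      = ∑' s, if s ≤ L then q ^ (s ^ 2) * r q s * r q (L - s) else 0 := by
    intro L
    rw [tsum_eq_sum (s := Finset.range (L + 1))]
    · apply Finset.sum_congr rfl
      intro s hs
      rw [if_pos (by simp at hs; omega)]
      ring
    · intro k hk
      rw [if_neg (by simp at hk; omega)]
  simp only [e]
  rw [← tsum_mul_right]
  apply tendsto_tsum_of_dominated_convergence (bound := fun k => ‖q‖ ^ k * (C * C))
    ((summable_geometric_of_lt_one (norm_nonneg _) hq).mul_right _)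
  · intro k
    have h1 : Tendsto (fun L => q ^ (k ^ 2) * r q k * r q (L - k)) atTop
        (𝓝 (q ^ (k ^ 2) * r q k * (qinf q q)⁻¹)) :=
      ((tendsto_r hq).comp (tendsto_sub_atTop_nat k)).const_mul _
    refine h1.congr' ?_
    filter_upwards [eventually_ge_atTop k] with L hL
    simp [hL]
  · refine Eventually.of_forall fun L k => ?_
    split_ifs
    · rw [norm_mul, norm_mul, norm_pow, mul_assoc]
      have h1 : ‖q‖ ^ (k ^ 2) ≤ ‖q‖ ^ k :=
        pow_le_pow_of_le_one (norm_nonneg _) hq.le (Nat.le_self_pow (by norm_num) k)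
      have h2 : ‖r q k‖ * ‖r q (L - k)‖ ≤ C * C :=
        mul_le_mul (hC _) (hC _) (norm_nonneg _) hC0
      exact mul_le_mul h1 h2 (by positivity) (by positivity)
    · simp; positivity

lemma al_summ {q x y : ℂ} (hq : ‖q‖ < 1) (hx : ‖x‖ < 1) (hy : ‖y‖ < 1) :
    Summable fun k => ‖al q x y k‖ := by
  refine Summable.of_nonneg_of_le (fun k => norm_nonneg _) (fun k => ?_)
    ((summable_geometric_of_lt_one (norm_nonneg _) hx).add
      (summable_geometric_of_lt_one (norm_nonneg _) hy))
  rcases k with _ | k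
  · simp [al]
  · rw [al_succ, norm_mul, norm_mul, norm_pow, norm_pow]
    simp only [norm_neg, norm_one, one_pow, one_mul]
    calc _ ≤ 1 * (‖x‖ ^ (k + 1) + ‖y‖ ^ (k + 1)) := by
          gcongr
          · exact pow_le_one₀ (norm_nonneg _) hq.le
          · rw [← norm_pow, ← norm_pow]; exact norm_add_le _ _
      _ = _ := one_mul _

/-- Jacobi triple product. -/
lemma jtp {q x y : ℂ} (hq : ‖q‖ < 1) (hx : ‖x‖ < 1) (hy : ‖y‖ < 1) (hxy : x * y = q) :
    ∑' k, al q x y k = qinf q x * qinf q y * qinf q q := by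
  have h1 := lim_b hq (al_summ hq hx hy)
  simp only [fjtp hq hxy] at h1
  have h2 : Tendsto (fun L => qPoch q x L * qPoch q y L * r q (2 * L)) atTop
      (𝓝 (qinf q x * qinf q y * (qinf q q)⁻¹)) :=
    ((tendsto_qPoch hq x).mul (tendsto_qPoch hq y)).mul
      ((tendsto_r hq).comp (tendsto_id.const_mul_atTop' (by norm_num : 0 < 2)))
  have h := tendsto_nhds_unique h1 h2
  have hne := qinf_ne hq hq
  field_simp at h
  linear_combination h

lemma norm_pow_lt {q : ℂ} (hq : ‖q‖ < 1) {n : ℕ} (hn : n ≠ 0) : ‖q ^ n‖ < 1 := by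
  rw [norm_pow]; exact pow_lt_one₀ (norm_nonneg _) hq hn

lemma qPoch_five (q : ℂ) (n : ℕ) : qPoch q q (5 * n) =
    qPoch (q ^ 5) (q ^ 1) n * qPoch (q ^ 5) (q ^ 2) n * qPoch (q ^ 5) (q ^ 3) n *
      qPoch (q ^ 5) (q ^ 4) n * qPoch (q ^ 5) (q ^ 5) n := by
  induction n with
  | zero => simp [qPoch]
  | succ n ih =>
    rw [show 5 * (n + 1) = 5 * n + 1 + 1 + 1 + 1 + 1 by ring]
    simp only [qPoch_succ]
    rw [ih]
    ring

lemma qinf_five {q : ℂ} (hq : ‖q‖ < 1) : qinf q q =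
    qinf (q ^ 5) (q ^ 1) * qinf (q ^ 5) (q ^ 2) * qinf (q ^ 5) (q ^ 3) *
      qinf (q ^ 5) (q ^ 4) * qinf (q ^ 5) (q ^ 5) := by
  have h5 := norm_pow_lt hq (show 5 ≠ 0 by norm_num)
  have h1 : Tendsto (fun n => qPoch q q (5 * n)) atTop (𝓝 (qinf q q)) :=
    (tendsto_qPoch hq q).comp (tendsto_id.const_mul_atTop' (by norm_num : 0 < 5))
  simp only [qPoch_five] at h1
  exact tendsto_nhds_unique h1 (((((tendsto_qPoch h5 _).mul (tendsto_qPoch h5 _)).mul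
    (tendsto_qPoch h5 _)).mul (tendsto_qPoch h5 _)).mul (tendsto_qPoch h5 _))

end RR

open RR

/-- The first Rogers–Ramanujan identity. -/
theorem rogers_ramanujan_first (q : ℂ) (hq : ‖q‖ < 1) :
    ∑' n : ℕ, q ^ (n ^ 2) / qPoch q q n =
      ∏' n : ℕ, 1 / ((1 - q ^ (5 * n + 1)) * (1 - q ^ (5 * n + 4))) := by
  have h5 := norm_pow_lt hq (show 5 ≠ 0 by norm_num)
  have hS := lim_s hq
  simp only [pair2 hq] at hS
  have hT := lim_b hq (al_summ h5 (norm_pow_lt hq (show 2 ≠ 0 by norm_num))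
    (norm_pow_lt hq (show 3 ≠ 0 by norm_num)))
  have h := tendsto_nhds_unique hS hT
  rw [jtp h5 (norm_pow_lt hq (show 2 ≠ 0 by norm_num))
    (norm_pow_lt hq (show 3 ≠ 0 by norm_num)) (by ring), qinf_five hq] at h
  have n1 := qinf_ne h5 (norm_pow_lt hq (show 1 ≠ 0 by norm_num))
  have n2 := qinf_ne h5 (norm_pow_lt hq (show 2 ≠ 0 by norm_num))
  have n3 := qinf_ne h5 (norm_pow_lt hq (show 3 ≠ 0 by norm_num))
  have n4 := qinf_ne h5 (norm_pow_lt hq (show 4 ≠ 0 by norm_num))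
  have n5 := qinf_ne h5 h5
  have hL : ∑' n : ℕ, q ^ (n ^ 2) / qPoch q q n
      = (qinf (q ^ 5) (q ^ 1) * qinf (q ^ 5) (q ^ 4))⁻¹ := by
    have e : ∑' n : ℕ, q ^ (n ^ 2) / qPoch q q n = ∑' s : ℕ, q ^ (s ^ 2) * r q s := by
      simp only [r, div_eq_mul_inv]
    rw [e]
    generalize (∑' s : ℕ, q ^ (s ^ 2) * r q s) = S at h ⊢
    clear hS hT
    generalize qinf (q ^ 5) (q ^ 1) = A1 at *
    generalize qinf (q ^ 5) (q ^ 2) = A2 at *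
    generalize qinf (q ^ 5) (q ^ 3) = A3 at *
    generalize qinf (q ^ 5) (q ^ 4) = A4 at *
    generalize qinf (q ^ 5) (q ^ 5) = A5 at *
    field_simp at h ⊢
    linear_combination h
  rw [hL]
  symm
  apply HasProd.tprod_eq
  have hp := ((mult_q h5 (q ^ 1)).hasProd.mul (mult_q h5 (q ^ 4)).hasProd)
  have hi := Filter.Tendsto.inv₀ hp (mul_ne_zero n1 n4)
  refine hi.congr fun s => ?_
  rw [← Finset.prod_inv_distrib]
  refine Finset.prod_congr rfl fun n _ => ?_
  simp only [one_div]
  congr 2 <;> ring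
end

section
/- Theorem (combinatorial telescoping for Watson's identity): Let n ≥ 1 and k ≥ 0 be integers and let N be a nonnegative integer. Then the number of elements of P_{n,k} of weight N equals the number of elements of P_{n,k} of weight N − n, plus the number of elements of P_{n−1,k} of weight N − (2n−1), plus the number of elements of H_{n,k} of weight N, plus the number of elements of H_{n,k+1} of weight N (where counts at negative weight are 0). -/
/-- Multiplicity of the part `j` in the partition `lam`, with the convention
`m_0(lam) = +∞`. -/
def multE (j : ℕ) (lam : Multiset ℕ) : ℕ∞ := if j = 0 then ⊤ else (lam.count j : ℕ∞)

/-- `P n k` is the set of pairs `(λ, μ)` of partitions such that `λ` has exactly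
`n - 2k` parts, every part of `λ` is at least `k` (and positive), no part of `λ`
equals `2k`, and every part of `μ` lies in `{1, …, k}`; it is empty when `n < 2k`. -/
def P (n k : ℕ) : Set (Multiset ℕ × Multiset ℕ) :=
  {p | p.1.card + 2 * k = n ∧ (∀ x ∈ p.1, k ≤ x ∧ 1 ≤ x ∧ x ≠ 2 * k) ∧
    ∀ x ∈ p.2, 1 ≤ x ∧ x ≤ k}

/-- The weight of an element of `P n k`: `k(5k-1)/2 + |λ| + |μ|`. -/
def wt (k : ℕ) (p : Multiset ℕ × Multiset ℕ) : ℕ :=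
  k * (5 * k - 1) / 2 + p.1.sum + p.2.sum

/-- `H n k = {(λ, μ) ∈ P n k : m_k(λ) + 2 > m_k(μ)}`, with the convention `m_0 = +∞`. -/
def H (n k : ℕ) : Set (Multiset ℕ × Multiset ℕ) :=
  {p ∈ P n k | multE k p.2 < multE k p.1 + 2}

abbrev WPair := Multiset ℕ × Multiset ℕ

def wsz (p : WPair) : ℕ := p.1.sum + p.2.sum

/-- all pairs, `m` parts at least `k`, second component with parts in `[1,k]`. -/
def WA (m k : ℕ) : Set WPair :=
  {p | p.1.card = m ∧ (∀ x ∈ p.1, k ≤ x) ∧ ∀ x ∈ p.2, 1 ≤ x ∧ x ≤ k}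

lemma w_bij {S T : Set WPair} (f g : WPair → WPair)
    (hf : ∀ p ∈ S, f p ∈ T ∧ g (f p) = p) (hg : ∀ p ∈ T, g p ∈ S ∧ f (g p) = p) :
    S.encard = T.encard := by
  have : Set.BijOn f S T := Set.InvOn.bijOn (f' := g)
    ⟨fun p hp => (hf p hp).2, fun p hp => (hg p hp).2⟩
    (fun p hp => (hf p hp).1) (fun p hp => (hg p hp).1)
  rw [← this.image_eq, this.injOn.encard_image]

lemma w_split {S A B : Set WPair} (h : ∀ p, p ∈ S ↔ p ∈ A ∨ p ∈ B)
    (hd : ∀ p, p ∈ A → p ∈ B → False) : S.encard = A.encard + B.encard := by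
  have : S = A ∪ B := by ext p; exact h p
  rw [this, Set.encard_union_eq]
  exact Set.disjoint_left.2 fun p h1 h2 => hd p h1 h2

def inc (s : Multiset ℕ) : Multiset ℕ := s.map (· + 1)
def dec (s : Multiset ℕ) : Multiset ℕ := s.map (· - 1)

lemma dec_inc (s : Multiset ℕ) : dec (inc s) = s := by simp [dec, inc]

lemma inc_dec (s : Multiset ℕ) (h : ∀ x ∈ s, 1 ≤ x) : inc (dec s) = s := by
  simp only [dec, inc, Multiset.map_map]
  conv_rhs => rw [← Multiset.map_id s]
  apply Multiset.map_congr rfl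
  intro x hx
  have := h x hx
  simp; omega

lemma sum_inc (s : Multiset ℕ) : (inc s).sum = s.sum + s.card := by
  simp [inc, Multiset.sum_map_add]

lemma card_inc (s : Multiset ℕ) : (inc s).card = s.card := by simp [inc]
lemma card_dec (s : Multiset ℕ) : (dec s).card = s.card := by simp [dec]

lemma sum_dec (s : Multiset ℕ) (h : ∀ x ∈ s, 1 ≤ x) : (dec s).sum + s.card = s.sum := by
  have := sum_inc (dec s)
  rw [inc_dec s h, card_dec] at this
  exact this.symm

lemma mem_inc {s : Multiset ℕ} {x : ℕ} : x ∈ inc s ↔ 1 ≤ x ∧ x - 1 ∈ s := by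
  simp only [inc, Multiset.mem_map]
  constructor
  · rintro ⟨a, ha, rfl⟩; simpa using ha
  · rintro ⟨h, h2⟩; exact ⟨_, h2, by omega⟩

lemma mem_dec {s : Multiset ℕ} {x : ℕ} (h : ∀ x ∈ s, 1 ≤ x) : x ∈ dec s ↔ x + 1 ∈ s := by
  conv_rhs => rw [← inc_dec s h]
  rw [mem_inc]; simp

def Phi (j : ℕ) (p : WPair) : WPair :=
  (p.1 - Multiset.replicate (min (p.1.count j) (p.2.count j)) j
    + Multiset.replicate (min (p.1.count j) (p.2.count j)) (2 * j),
   p.2 - Multiset.replicate (min (p.1.count j) (p.2.count j)) j)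

def Psi (j : ℕ) (p : WPair) : WPair :=
  (p.1 - Multiset.replicate (p.1.count (2 * j)) (2 * j)
    + Multiset.replicate (p.1.count (2 * j)) j,
   p.2 + Multiset.replicate (p.1.count (2 * j)) j)

/-- pairs with no `2j` in the first component. -/
def WP (m j : ℕ) : Set WPair := {p | p ∈ WA m j ∧ 2 * j ∉ p.1}

/-- pairs with `j` not in both components. -/
def WQ (m j : ℕ) : Set WPair := {p | p ∈ WA m j ∧ (j ∉ p.1 ∨ j ∉ p.2)}

lemma count1_Phi {j : ℕ} (hj : 1 ≤ j) (p : WPair) :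
    (Phi j p).1.count j = p.1.count j - min (p.1.count j) (p.2.count j) := by
  have : 2 * j ≠ j := by omega
  simp [Phi, Multiset.count_replicate, this]

lemma count2_Phi (j : ℕ) (p : WPair) :
    (Phi j p).2.count j = p.2.count j - min (p.1.count j) (p.2.count j) := by
  simp [Phi]

lemma w_sub_add (s : Multiset ℕ) (j t : ℕ) (h : t ≤ s.count j) :
    s - Multiset.replicate t j + Multiset.replicate t j = s := by
  apply tsub_add_cancel_of_le
  exact Multiset.le_count_iff_replicate_le.1 h

lemma w_sub_sum (s : Multiset ℕ) (j t : ℕ) (h : t ≤ s.count j) :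
    (s - Multiset.replicate t j).sum + t * j = s.sum := by
  conv_rhs => rw [← w_sub_add s j t h]
  simp

lemma w_sub_card (s : Multiset ℕ) (j t : ℕ) (h : t ≤ s.count j) :
    (s - Multiset.replicate t j).card + t = s.card := by
  conv_rhs => rw [← w_sub_add s j t h]
  simp

lemma wsz_Phi (j : ℕ) (p : WPair) : wsz (Phi j p) = wsz p := by
  have h1 := w_sub_sum p.1 j (min (p.1.count j) (p.2.count j)) (min_le_left _ _)
  have h2 := w_sub_sum p.2 j (min (p.1.count j) (p.2.count j)) (min_le_right _ _)
  simp only [wsz, Phi, Multiset.sum_add, Multiset.sum_replicate, smul_eq_mul]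
  linarith

lemma wsz_Psi (j : ℕ) (p : WPair) : wsz (Psi j p) = wsz p := by
  have h1 := w_sub_sum p.1 (2 * j) (p.1.count (2 * j)) le_rfl
  simp only [wsz, Psi, Multiset.sum_add, Multiset.sum_replicate, smul_eq_mul]
  linarith

lemma Phi_mem {m j : ℕ} (hj : 1 ≤ j) {p : WPair} (hp : p ∈ WP m j) : Phi j p ∈ WQ m j := by
  obtain ⟨⟨h1, h2, h3⟩, h4⟩ := hp
  refine ⟨⟨?_, ?_, ?_⟩, ?_⟩
  · have := w_sub_card p.1 j (min (p.1.count j) (p.2.count j)) (min_le_left _ _)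
    simp only [Phi, Multiset.card_add, Multiset.card_replicate]
    omega
  · intro x hx
    simp only [Phi, Multiset.mem_add] at hx
    rcases hx with hx | hx
    · exact h2 x (Multiset.mem_of_le (Multiset.sub_le_self _ _) hx)
    · have := Multiset.eq_of_mem_replicate hx; omega
  · intro x hx
    exact h3 x (Multiset.mem_of_le (Multiset.sub_le_self _ _) hx)
  · rw [← Multiset.count_eq_zero, ← Multiset.count_eq_zero, count1_Phi hj, count2_Phi]
    omega

lemma Psi_mem {m j : ℕ} (hj : 1 ≤ j) {p : WPair} (hp : p ∈ WQ m j) : Psi j p ∈ WP m j := by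
  obtain ⟨⟨h1, h2, h3⟩, h4⟩ := hp
  refine ⟨⟨?_, ?_, ?_⟩, ?_⟩
  · have := w_sub_card p.1 (2 * j) (p.1.count (2 * j)) le_rfl
    simp only [Psi, Multiset.card_add, Multiset.card_replicate]
    omega
  · intro x hx
    simp only [Psi, Multiset.mem_add] at hx
    rcases hx with hx | hx
    · exact h2 x (Multiset.mem_of_le (Multiset.sub_le_self _ _) hx)
    · have := Multiset.eq_of_mem_replicate hx; omega
  · intro x hx
    simp only [Psi, Multiset.mem_add] at hx
    rcases hx with hx | hx
    · exact h3 x hx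
    · have := Multiset.eq_of_mem_replicate hx; omega
  · rw [← Multiset.count_eq_zero]
    have : j ≠ 2 * j := by omega
    simp [Psi, Multiset.count_replicate, this]

lemma Psi_Phi {m j : ℕ} (hj : 1 ≤ j) {p : WPair} (hp : p ∈ WP m j) : Psi j (Phi j p) = p := by
  obtain ⟨-, h4⟩ := hp
  have h0 : p.1.count (2 * j) = 0 := Multiset.count_eq_zero.2 h4
  have hne : j ≠ 2 * j := by omega
  have hc : (Phi j p).1.count (2 * j) = min (p.1.count j) (p.2.count j) := by
    simp [Phi, Multiset.count_replicate, hne, h0]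
  unfold Psi
  rw [hc]
  ext1
  · simp only [Phi]
    rw [add_tsub_cancel_right]
    exact w_sub_add _ _ _ (min_le_left _ _)
  · exact w_sub_add _ _ _ (min_le_right _ _)

lemma Phi_Psi {m j : ℕ} (hj : 1 ≤ j) {p : WPair} (hp : p ∈ WQ m j) : Phi j (Psi j p) = p := by
  obtain ⟨-, h4⟩ := hp
  rw [← Multiset.count_eq_zero, ← Multiset.count_eq_zero] at h4
  have hne : 2 * j ≠ j := by omega
  have hc : min ((Psi j p).1.count j) ((Psi j p).2.count j) = p.1.count (2 * j) := by
    have e1 : (Psi j p).1.count j = p.1.count j + p.1.count (2 * j) := by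
      simp [Psi, Multiset.count_replicate, hne]
    have e2 : (Psi j p).2.count j = p.2.count j + p.1.count (2 * j) := by
      simp [Psi]
    omega
  unfold Phi
  rw [hc]
  ext1
  · simp only [Psi]
    rw [add_tsub_cancel_right]
    exact w_sub_add _ _ _ le_rfl
  · simp [Psi]

/-- transfer along `Phi` with a condition on counts -/
lemma w_transfer {m j : ℕ} (hj : 1 ≤ j) (t N : ℕ) (C : WPair → Prop) (D : WPair → Prop)
    (hCD : ∀ p ∈ WP m j, C p ↔ D (Phi j p)) :
    {p | (p ∈ WP m j ∧ C p) ∧ wsz p + t = N}.encard =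
      {p | (p ∈ WQ m j ∧ D p) ∧ wsz p + t = N}.encard := by
  apply w_bij (Phi j) (Psi j)
  · rintro p ⟨⟨hp, hc⟩, hw⟩
    exact ⟨⟨⟨Phi_mem hj hp, (hCD p hp).1 hc⟩, by rw [wsz_Phi]; exact hw⟩, Psi_Phi hj hp⟩
  · rintro p ⟨⟨hp, hc⟩, hw⟩
    refine ⟨⟨⟨Psi_mem hj hp, (hCD _ (Psi_mem hj hp)).2 ?_⟩, by rw [wsz_Psi]; exact hw⟩,
      Phi_Psi hj hp⟩
    rw [Phi_Psi hj hp]; exact hc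

/-- the positive-`k` version of step G -/
lemma w_G {m k : ℕ} (hk : 1 ≤ k) (t N : ℕ) :
    {p | (p ∈ WP m k ∧ p.1.count k + 2 ≤ p.2.count k) ∧ wsz p + t = N}.encard =
      {p | p ∈ WA m k ∧ wsz p + (m + 2 * k) + t = N}.encard := by
  rw [w_transfer hk t N _ (fun p => p.1.count k + 2 ≤ p.2.count k)]
  · apply w_bij (fun p => (dec p.1, p.2 - Multiset.replicate 2 k))
      (fun p => (inc p.1, p.2 + Multiset.replicate 2 k))
    · rintro ⟨a, b⟩ ⟨⟨⟨⟨h1, h2, h3⟩, h4⟩, h5⟩, h6⟩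
      simp only [wsz] at *
      have hka : k ∉ a := by
        rcases h4 with h | h
        · exact h
        · have := Multiset.count_eq_zero.2 h; omega
      have hpos : ∀ x ∈ a, 1 ≤ x := fun x hx => by have := h2 x hx; omega
      have e1 := sum_dec a hpos
      have e2 := w_sub_sum b k 2 (by omega)
      have e3 := w_sub_add b k 2 (by omega)
      refine ⟨⟨⟨by simp [card_dec, h1], ?_, ?_⟩, ?_⟩, ?_⟩
      · intro x hx
        simp only [mem_dec hpos] at hx
        have := h2 _ hx
        have : x + 1 ≠ k := by rintro rfl; exact hka hx
        omega
      · intro x hx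
        exact h3 x (Multiset.mem_of_le (Multiset.sub_le_self _ _) hx)
      · simp only; omega
      · simp only [inc_dec a hpos, e3]
    · rintro ⟨a, b⟩ ⟨⟨h1, h2, h3⟩, h6⟩
      simp only [wsz] at *
      have hka : k ∉ inc a := by
        rw [mem_inc]; rintro ⟨_, h⟩; have := h2 _ h; omega
      have hc := Multiset.count_eq_zero.2 hka
      refine ⟨⟨⟨⟨⟨by simp [card_inc, h1], ?_, ?_⟩, Or.inl hka⟩, ?_⟩, ?_⟩, ?_⟩
      · intro x hx
        simp only [mem_inc] at hx
        have := h2 _ hx.2; omega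
      · intro x hx
        simp only [Multiset.mem_add] at hx
        rcases hx with hx | hx
        · exact h3 x hx
        · have := Multiset.eq_of_mem_replicate hx; omega
      · simp only [hc, Multiset.count_add, Multiset.count_replicate_self]; omega
      · simp only [sum_inc, Multiset.sum_add, Multiset.sum_replicate, smul_eq_mul]; omega
      · simp [dec_inc]
  · intro p hp
    rw [count1_Phi hk, count2_Phi]; omega

lemma w_G0 (m t N : ℕ) :
    {p | p ∈ WP m 0 ∧ wsz p + t = N}.encard =
      {p | p ∈ WA m 0 ∧ wsz p + m + t = N}.encard := by
  apply w_bij (fun p => (dec p.1, p.2)) (fun p => (inc p.1, p.2))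
  · rintro ⟨a, b⟩ ⟨⟨⟨h1, h2, h3⟩, h4⟩, h6⟩
    simp only [wsz] at *
    have hpos : ∀ x ∈ a, 1 ≤ x := fun x hx => by
      rcases Nat.eq_zero_or_pos x with rfl | h
      · exact absurd hx h4
      · exact h
    have e1 := sum_dec a hpos
    refine ⟨⟨⟨by simp [card_dec, h1], fun _ _ => Nat.zero_le _, h3⟩, ?_⟩, ?_⟩
    · simp only; omega
    · simp only [inc_dec a hpos]
  · rintro ⟨a, b⟩ ⟨⟨h1, h2, h3⟩, h6⟩
    simp only [wsz] at *
    refine ⟨⟨⟨⟨by simp [card_inc, h1], fun _ _ => Nat.zero_le _, h3⟩, ?_⟩, ?_⟩, ?_⟩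
    · simp [mem_inc]
    · simp only [sum_inc]; omega
    · simp [dec_inc]

/-- split of `WA` according to `2k`. -/
lemma w_A_split (m k t N : ℕ) :
    {p | p ∈ WA m k ∧ wsz p + t = N}.encard =
      {p | p ∈ WP m k ∧ wsz p + t = N}.encard +
      {p | (p ∈ WA m k ∧ 2 * k ∈ p.1) ∧ wsz p + t = N}.encard := by
  apply w_split
  · intro p; simp only [WP, Set.mem_ofPred_eq]; tauto
  · intro p; simp only [WP, Set.mem_ofPred_eq]; tauto

/-- remove one part `c` -/
lemma w_remove (m k c t N : ℕ) (hc : k ≤ c) :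
    {p | (p ∈ WA (m + 1) k ∧ c ∈ p.1) ∧ wsz p + t = N}.encard =
      {p | p ∈ WA m k ∧ wsz p + c + t = N}.encard := by
  apply w_bij (fun p => (p.1.erase c, p.2)) (fun p => (c ::ₘ p.1, p.2))
  · rintro ⟨a, b⟩ ⟨⟨⟨h1, h2, h3⟩, h4⟩, h6⟩
    simp only [wsz] at *
    obtain ⟨a, rfl⟩ := Multiset.exists_cons_of_mem h4
    simp only [Multiset.card_cons, Multiset.sum_cons, Multiset.erase_cons_head] at *
    refine ⟨⟨⟨by simpa using h1, fun x hx => h2 x (Multiset.mem_cons_of_mem hx), h3⟩, ?_⟩, by trivial⟩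
    simp only; omega
  · rintro ⟨a, b⟩ ⟨⟨h1, h2, h3⟩, h6⟩
    simp only [wsz] at *
    refine ⟨⟨⟨⟨by simp [h1], ?_, h3⟩, by simp⟩, ?_⟩, by simp⟩
    · intro x hx
      simp only [Multiset.mem_cons] at hx
      rcases hx with rfl | hx
      · exact hc
      · exact h2 x hx
    · simp only [Multiset.sum_cons]; omega

/-- elements of `WA` without `k` and `2k+1`: subtract one. -/
lemma w_P2 (m k t N : ℕ) :
    {p | (p ∈ WA m k ∧ k ∉ p.1 ∧ 2 * k + 1 ∉ p.1) ∧ wsz p + t = N}.encard =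
      {p | p ∈ WP m k ∧ wsz p + m + t = N}.encard := by
  apply w_bij (fun p => (dec p.1, p.2)) (fun p => (inc p.1, p.2))
  · rintro ⟨a, b⟩ ⟨⟨⟨h1, h2, h3⟩, h4, h5⟩, h6⟩
    simp only [wsz] at *
    have hk1 : ∀ x ∈ a, k + 1 ≤ x := fun x hx => by
      have := h2 x hx
      have : x ≠ k := by rintro rfl; exact h4 hx
      omega
    have hpos : ∀ x ∈ a, 1 ≤ x := fun x hx => by have := hk1 x hx; omega
    have e1 := sum_dec a hpos
    refine ⟨⟨⟨⟨by simp [card_dec, h1], ?_, h3⟩, ?_⟩, ?_⟩, ?_⟩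
    · intro x hx
      simp only [mem_dec hpos] at hx
      have := hk1 _ hx; omega
    · simpa only [mem_dec hpos] using h5
    · simp only; omega
    · simp only [inc_dec a hpos]
  · rintro ⟨a, b⟩ ⟨⟨⟨h1, h2, h3⟩, h5⟩, h6⟩
    simp only [wsz] at *
    refine ⟨⟨⟨⟨by simp [card_inc, h1], ?_, h3⟩, ?_, ?_⟩, ?_⟩, ?_⟩
    · intro x hx
      simp only [mem_inc] at hx
      have := h2 _ hx.2; omega
    · simp only [mem_inc]; rintro ⟨_, h⟩; have := h2 _ h; omega
    · simpa [mem_inc] using h5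
    · simp only [sum_inc]; omega
    · simp [dec_inc]

/-- the part of `R` containing `k`. -/
lemma w_R1 (m k t N : ℕ) :
    {p | (p ∈ WA (m + 1) k ∧ k ∈ p.1) ∧ wsz p + (m + t) = N}.encard =
      {p | (p ∈ WQ m (k + 1) ∧ p.2.count (k + 1) = 0) ∧ wsz p + k + t = N}.encard := by
  rw [w_remove m k k _ _ le_rfl]
  apply w_bij (fun p => (inc p.1, p.2)) (fun p => (dec p.1, p.2))
  · rintro ⟨a, b⟩ ⟨⟨h1, h2, h3⟩, h6⟩
    simp only [wsz] at *
    have hb : k + 1 ∉ b := fun h => by have := h3 _ h; omega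
    refine ⟨⟨⟨⟨⟨by simp [card_inc, h1], ?_, ?_⟩, Or.inr hb⟩, Multiset.count_eq_zero.2 hb⟩, ?_⟩, ?_⟩
    · intro x hx
      simp only [mem_inc] at hx
      have := h2 _ hx.2; omega
    · intro x hx; have := h3 x hx; omega
    · simp only [sum_inc]; omega
    · simp [dec_inc]
  · rintro ⟨a, b⟩ ⟨⟨⟨⟨h1, h2, h3⟩, -⟩, h4⟩, h6⟩
    simp only [wsz] at *
    have hb : k + 1 ∉ b := Multiset.count_eq_zero.1 h4
    have hpos : ∀ x ∈ a, 1 ≤ x := fun x hx => by have := h2 x hx; omega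
    have e1 := sum_dec a hpos
    refine ⟨⟨⟨by simp [card_dec, h1], ?_, ?_⟩, ?_⟩, ?_⟩
    · intro x hx
      simp only [mem_dec hpos] at hx
      have := h2 _ hx; omega
    · intro x hx
      have := h3 x hx
      have : x ≠ k + 1 := by rintro rfl; exact hb hx
      omega
    · simp only; omega
    · simp only [inc_dec a hpos]

/-- the part of `R` not containing `k`, but containing `2k+1`. -/
lemma w_R2 (m k t N : ℕ) :
    {p | (p ∈ WA (m + 1) k ∧ k ∉ p.1 ∧ 2 * k + 1 ∈ p.1) ∧ wsz p + (m + t) = N}.encard =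
      {p | (p ∈ WQ m (k + 1) ∧ p.2.count (k + 1) = 1) ∧ wsz p + k + t = N}.encard := by
  apply w_bij (fun p => (inc (p.1.erase (2 * k + 1)), (k + 1) ::ₘ p.2))
    (fun p => ((2 * k + 1) ::ₘ dec p.1, p.2.erase (k + 1)))
  · rintro ⟨a, b⟩ ⟨⟨⟨h1, h2, h3⟩, h4, h5⟩, h6⟩
    simp only [wsz] at *
    obtain ⟨a, rfl⟩ := Multiset.exists_cons_of_mem h5
    simp only [Multiset.card_cons, Multiset.sum_cons, Multiset.erase_cons_head] at *
    have hb : k + 1 ∉ b := fun h => by have := h3 _ h; omega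
    have hk1 : ∀ x ∈ a, k + 1 ≤ x := fun x hx => by
      have := h2 x (Multiset.mem_cons_of_mem hx)
      have : x ≠ k := by rintro rfl; exact h4 (Multiset.mem_cons_of_mem hx)
      omega
    refine ⟨⟨⟨⟨⟨by simp [card_inc]; omega, ?_, ?_⟩, Or.inl ?_⟩, ?_⟩, ?_⟩, ?_⟩
    · intro x hx
      simp only [mem_inc] at hx
      have := hk1 _ hx.2; omega
    · intro x hx
      simp only [Multiset.mem_cons] at hx
      rcases hx with rfl | hx
      · omega
      · have := h3 x hx; omega
    · simp only [mem_inc]; rintro ⟨_, h⟩; have := hk1 _ h; omega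
    · simp only [Multiset.count_cons_self, Multiset.count_eq_zero.2 hb]
    · simp only [sum_inc, Multiset.sum_cons]; omega
    · simp [dec_inc]
  · rintro ⟨a, b⟩ ⟨⟨⟨⟨h1, h2, h3⟩, h5⟩, h4⟩, h6⟩
    simp only [wsz] at *
    have hb : k + 1 ∈ b := Multiset.count_pos.1 (by omega)
    have ha : k + 1 ∉ a := by tauto
    obtain ⟨b, rfl⟩ := Multiset.exists_cons_of_mem hb
    simp only [Multiset.count_cons_self, Multiset.sum_cons, Multiset.erase_cons_head] at *
    have hb' : k + 1 ∉ b := Multiset.count_eq_zero.1 (by omega)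
    have hpos : ∀ x ∈ a, 1 ≤ x := fun x hx => by have := h2 x hx; omega
    have e1 := sum_dec a hpos
    have hd : ∀ x ∈ dec a, k + 1 ≤ x := by
      intro x hx
      simp only [mem_dec hpos] at hx
      have := h2 _ hx
      have : x + 1 ≠ k + 1 := by intro h; rw [h] at hx; exact ha hx
      omega
    refine ⟨⟨⟨⟨by simp [card_dec, h1], ?_, ?_⟩, ?_, by simp⟩, ?_⟩, ?_⟩
    · intro x hx
      simp only [Multiset.mem_cons] at hx
      rcases hx with rfl | hx
      · omega
      · have := hd x hx; omega
    · intro x hx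
      have := h3 x (Multiset.mem_cons_of_mem hx)
      have : x ≠ k + 1 := by rintro rfl; exact hb' hx
      omega
    · simp only [Multiset.mem_cons]
      rintro (h | h)
      · omega
      · have := hd _ h; omega
    · simp only [Multiset.sum_cons]; omega
    · simp only [inc_dec a hpos]

lemma w_H (m k t N : ℕ) :
    {p | (p ∈ WP m (k + 1) ∧ p.2.count (k + 1) < p.1.count (k + 1) + 2) ∧
        wsz p + k + t = N}.encard =
      {p | (p ∈ WA (m + 1) k ∧ k ∈ p.1) ∧ wsz p + (m + t) = N}.encard +
      {p | (p ∈ WA (m + 1) k ∧ k ∉ p.1 ∧ 2 * k + 1 ∈ p.1) ∧ wsz p + (m + t) = N}.encard := by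
  rw [w_R1, w_R2]
  simp only [add_assoc]
  rw [w_transfer (by omega) (k + t) N _ (fun p => p.2.count (k + 1) ≤ 1)]
  · apply w_split
    · rintro p
      simp only [Set.mem_ofPred_eq, Nat.le_one_iff_eq_zero_or_eq_one]
      tauto
    · rintro p ⟨⟨_, h⟩, _⟩ ⟨⟨_, h'⟩, _⟩; omega
  · intro p hp
    rw [count2_Phi]; omega

/-- the second half of the argument -/
lemma w_second (m k t N : ℕ) :
    {p | p ∈ WA (m + 1) k ∧ wsz p + (m + t) = N}.encard =
      {p | p ∈ WP (m + 1) k ∧ wsz p + (m + 1) + (m + t) = N}.encard +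
      {p | (p ∈ WP m (k + 1) ∧ p.2.count (k + 1) < p.1.count (k + 1) + 2) ∧
        wsz p + k + t = N}.encard := by
  rw [w_H, ← w_P2]
  rw [w_split (S := {p | p ∈ WA (m + 1) k ∧ wsz p + (m + t) = N})
    (A := {p | (p ∈ WA (m + 1) k ∧ k ∉ p.1 ∧ 2 * k + 1 ∉ p.1) ∧ wsz p + (m + t) = N})
    (B := {p | (p ∈ WA (m + 1) k ∧ ¬ (k ∉ p.1 ∧ 2 * k + 1 ∉ p.1)) ∧ wsz p + (m + t) = N})]
  · congr 1
    apply w_split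
    · intro p; simp only [Set.mem_ofPred_eq]; tauto
    · intro p; simp only [Set.mem_ofPred_eq]; tauto
  · intro p; simp only [Set.mem_ofPred_eq]; tauto
  · intro p; simp only [Set.mem_ofPred_eq]; tauto

lemma mem_P_iff (m k : ℕ) (p : WPair) : p ∈ P (m + 2 * k) k ↔ p ∈ WP m k := by
  simp only [P, WP, WA, Set.mem_ofPred_eq]
  constructor
  · rintro ⟨h1, h2, h3⟩
    exact ⟨⟨by omega, fun x hx => (h2 x hx).1, h3⟩, fun h => (h2 _ h).2.2 rfl⟩
  · rintro ⟨⟨h1, h2, h3⟩, h4⟩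
    refine ⟨by omega, fun x hx => ?_, h3⟩
    have hx2 : x ≠ 2 * k := by rintro rfl; exact h4 hx
    have := h2 x hx
    exact ⟨this, by omega, hx2⟩

lemma P_empty {n k : ℕ} (h : n < 2 * k) (p : WPair) : p ∉ P n k := by
  rintro ⟨h1, _⟩; omega

lemma mem_H_iff (n k : ℕ) (hk : 1 ≤ k) (p : WPair) :
    p ∈ H n k ↔ p ∈ P n k ∧ p.2.count k < p.1.count k + 2 := by
  have : k ≠ 0 := by omega
  simp only [H, multE, this, if_false, Set.mem_ofPred_eq]
  refine and_congr_right fun _ => ?_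
  exact_mod_cast Iff.rfl

lemma H_zero (n : ℕ) (p : WPair) : p ∉ H n 0 := by
  simp [H, multE]

lemma w_trap (k : ℕ) : (k + 1) * (5 * (k + 1) - 1) / 2 = k * (5 * k - 1) / 2 + (5 * k + 2) := by
  have : (k + 1) * (5 * (k + 1) - 1) = k * (5 * k - 1) + (5 * k + 2) * 2 := by
    rcases k with _ | k
    · rfl
    · have e1 : 5 * (k + 1 + 1) - 1 = 5 * k + 9 := by omega
      have e2 : 5 * (k + 1) - 1 = 5 * k + 4 := by omega
      rw [e1, e2]; ring
  rw [this, Nat.add_mul_div_right _ _ (by norm_num)]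

lemma wt_eq (k : ℕ) (p : WPair) : wt k p = wsz p + k * (5 * k - 1) / 2 := by
  simp only [wt, wsz]; ring

lemma w_le {s : Multiset ℕ} {N : ℕ} (hpos : ∀ x ∈ s, 1 ≤ x) (hs : s.sum ≤ N) :
    s ≤ N • Multiset.range (N + 1) := by
  have hc : s.card ≤ s.sum := by
    have := Multiset.card_nsmul_le_sum (s := s) (a := 1) hpos
    simpa using this
  rw [Multiset.le_iff_count]
  intro a
  by_cases ha : a ∈ s
  · have h1 : a ≤ s.sum := Multiset.le_sum_of_mem ha
    have h2 : (Multiset.range (N + 1)).count a = 1 :=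
      Multiset.count_eq_one_of_mem (Multiset.nodup_range _) (by simp; omega)
    rw [Multiset.count_nsmul, h2]
    have := Multiset.count_le_card a s
    omega
  · simp [Multiset.count_eq_zero.2 ha]

lemma w_finite (n k N : ℕ) : {p | p ∈ P n k ∧ wt k p = N}.Finite := by
  apply Set.Finite.subset ((Set.finite_Iic (N • Multiset.range (N + 1))).prod
    (Set.finite_Iic (N • Multiset.range (N + 1))))
  rintro p ⟨⟨h1, h2, h3⟩, h4⟩
  simp only [wt] at h4
  exact ⟨w_le (fun x hx => (h2 x hx).2.1) (by omega), w_le (fun x hx => (h3 x hx).1) (by omega)⟩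

lemma w_empty {C : WPair → Prop} (h : ∀ p, ¬ C p) : {p | C p}.encard = 0 := by
  rw [Set.encard_eq_zero]; ext p; simpa using h p

/-- splitting off `H` and applying step G, for all `k`. -/
lemma w_first (m k N : ℕ) :
    {p | p ∈ P (m + 2 * k) k ∧ wt k p = N}.encard =
      {p | p ∈ H (m + 2 * k) k ∧ wt k p = N}.encard +
      {p | p ∈ WA m k ∧ wsz p + (m + 2 * k) + k * (5 * k - 1) / 2 = N}.encard := by
  rcases Nat.eq_zero_or_pos k with rfl | hk
  · rw [w_empty (C := fun p => p ∈ H _ 0 ∧ _) (fun p hp => H_zero _ p hp.1), zero_add]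
    have := w_G0 m 0 N
    simp only [mem_P_iff, wt_eq]
    simpa only [Nat.zero_mul, Nat.zero_div, Nat.mul_zero, Nat.add_zero] using this
  · rw [← w_G hk]
    apply w_split
    · intro p
      simp only [Set.mem_ofPred_eq, mem_H_iff _ _ hk, mem_P_iff, wt_eq, ← not_lt]; tauto
    · intro p
      simp only [Set.mem_ofPred_eq, mem_H_iff _ _ hk, mem_P_iff, wt_eq, ← not_lt]; tauto

lemma watson_encard (n k N : ℕ) (hn : 1 ≤ n) :
    {p | p ∈ P n k ∧ wt k p = N}.encard =
      {p | p ∈ P n k ∧ wt k p + n = N}.encard +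
      {p | p ∈ P (n - 1) k ∧ wt k p + (2 * n - 1) = N}.encard +
      {p | p ∈ H n k ∧ wt k p = N}.encard +
      {p | p ∈ H n (k + 1) ∧ wt (k + 1) p = N}.encard := by
  rcases lt_or_ge n (2 * k) with h | h
  · rw [w_empty (fun p hp => P_empty h p hp.1), w_empty (fun p hp => P_empty h p hp.1),
      w_empty (fun p hp => P_empty (by omega) p hp.1),
      w_empty (fun p hp => P_empty h p hp.1.1),
      w_empty (fun p hp => P_empty (by omega) p hp.1.1)]
    rfl
  obtain ⟨m, rfl⟩ : ∃ m, n = m + 2 * k := ⟨n - 2 * k, by omega⟩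
  rw [w_first]
  simp only [add_assoc]
  rw [w_A_split]
  have key : {p | (p ∈ WA m k ∧ 2 * k ∈ p.1) ∧
        wsz p + (m + (2 * k + k * (5 * k - 1) / 2)) = N}.encard =
      {p | p ∈ P (m + 2 * k - 1) k ∧ wt k p + (2 * (m + 2 * k) - 1) = N}.encard +
      {p | p ∈ H (m + 2 * k) (k + 1) ∧ wt (k + 1) p = N}.encard := by
    rcases m with _ | m
    · rw [w_empty, w_empty (fun p hp => P_empty (by omega) p hp.1),
        w_empty (fun p hp => P_empty (by omega) p hp.1.1)]
      · rfl
      · rintro p ⟨⟨⟨h1, _⟩, h2⟩, _⟩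
        rw [Multiset.card_eq_zero] at h1
        rw [h1] at h2; simp at h2
    · rw [w_remove _ _ _ _ _ (by omega)]
      have em : m + 1 + 2 * k - 1 = m + 2 * k := by omega
      rw [em]
      rcases m with _ | m
      · rw [w_empty (C := fun p => p ∈ H _ _ ∧ _)
          (fun p hp => P_empty (by omega) p hp.1.1), add_zero]
        congr 1
        ext p
        simp only [Set.mem_ofPred_eq, mem_P_iff, wt_eq, WP, WA]
        constructor
        · rintro ⟨⟨h1, h2, h3⟩, h4⟩
          refine ⟨⟨⟨h1, h2, h3⟩, ?_⟩, by omega⟩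
          rw [Multiset.card_eq_zero] at h1
          rw [h1]; simp
        · rintro ⟨⟨h1, _⟩, h4⟩
          exact ⟨h1, by omega⟩
      · have := w_second m k (4 * k + 2 + k * (5 * k - 1) / 2) N
        have eH : m + 1 + 1 + 2 * k = m + 2 * (k + 1) := by ring
        rw [eH]
        simp only [mem_H_iff _ _ (Nat.succ_le_succ (Nat.zero_le k)), mem_P_iff, wt_eq, w_trap]
        convert this using 3
        · ext p; refine and_congr_right fun _ => ?_; omega
        · congr 1; ext p; refine and_congr_right fun _ => ?_; omega
        · ext p; refine and_congr_right fun _ => ?_; omega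
  rw [key]
  have e1 : {p | p ∈ WP m k ∧ wsz p + (m + (2 * k + k * (5 * k - 1) / 2)) = N} =
      {p | p ∈ P (m + 2 * k) k ∧ wt k p + (m + 2 * k) = N} := by
    ext p
    simp only [Set.mem_ofPred_eq, mem_P_iff, wt_eq]
    refine and_congr_right fun _ => ?_
    omega
  rw [e1]
  have wcomm : ∀ a b c d : ℕ∞, b + (a + (c + d)) = a + (c + (b + d)) := by
    intro a b c d; ring
  exact wcomm _ _ _ _

/-- Combinatorial telescoping for Watson's identity. -/
theorem watson_telescoping (n k N : ℕ) (hn : 1 ≤ n) :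
    Nat.card {p | p ∈ P n k ∧ wt k p = N} =
      Nat.card {p | p ∈ P n k ∧ wt k p + n = N} +
      Nat.card {p | p ∈ P (n - 1) k ∧ wt k p + (2 * n - 1) = N} +
      Nat.card {p | p ∈ H n k ∧ wt k p = N} +
      Nat.card {p | p ∈ H n (k + 1) ∧ wt (k + 1) p = N} := by
  have h := watson_encard n k N hn
  have hf := (w_finite n k N).encard_lt_top
  simp only [Nat.card_coe_set_eq, Set.ncard]
  rw [h] at hf ⊢
  simp only [ENat.add_lt_top] at hf
  obtain ⟨⟨⟨h1, h2⟩, h3⟩, h4⟩ := hf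
  rw [ENat.toNat_add (ENat.add_lt_top.2 ⟨ENat.add_lt_top.2 ⟨h1, h2⟩, h3⟩).ne h4.ne,
    ENat.toNat_add (ENat.add_lt_top.2 ⟨h1, h2⟩).ne h3.ne, ENat.toNat_add h1.ne h2.ne]
end
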